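/- Let α and β be positive real algebraic numbers such that β/α is irrational. Then there exists a positive constant C = C(α,β) such that for all positive integers h₁, h₂, r₁, r₂ with M := max{h₁, h₂, r₁, r₂} ≥ 3, if h₁^α r₁^β ≠ h₂^α r₂^β, then |h₁^α r₁^β − h₂^α r₂^β| > exp{ −C (log M)² log log M }. -/

import Mathlib

open Real


namespace LBE
open Polynomial Finset Matrix

theorem coeff_prod_le {ι R : Type*} [CommRing R] (s : Finset ι) (f : ι → R[X]) (d : ι → ℕ)
    (h : ∀ i ∈ s, (f i).natDegree ≤ d i) :
    (∏ i ∈ s, f i).coeff (∑ i ∈ s, d i) = ∏ i ∈ s, (f i).coeff (d i) := by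
  classical
  induction s using Finset.induction_on with
  | empty => simp
  | insert a s ha ih =>
    rw [prod_insert ha, sum_insert ha, prod_insert ha,
      coeff_mul_add_eq_of_natDegree_le (h a (mem_insert_self a s)) ?_, ih (fun i hi => h i (mem_insert_of_mem hi))]
    refine (natDegree_prod_le _ _).trans (sum_le_sum fun i hi => h i (mem_insert_of_mem hi))

theorem coeff_det_le {n R : Type*} [Fintype n] [DecidableEq n] [CommRing R]
    (B : Matrix n n R[X]) (d : n → ℕ) (h : ∀ i j, (B i j).natDegree ≤ d j) :
    (det B).coeff (∑ j, d j) = det (Matrix.of fun i j => (B i j).coeff (d j)) := by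
  rw [det_apply, det_apply, finsetSum_coeff]
  refine sum_congr rfl fun σ _ => ?_
  rw [coeff_smul, coeff_prod_le _ _ _ (fun i _ => h _ _)]
  simp

theorem natDegree_det_le' {n R : Type*} [Fintype n] [DecidableEq n] [CommRing R]
    (B : Matrix n n R[X]) (d : n → ℕ) (h : ∀ i j, (B i j).natDegree ≤ d j) :
    (det B).natDegree ≤ ∑ j, d j := by
  rw [det_apply]
  refine natDegree_sum_le_of_forall_le _ _ fun σ _ => ?_
  refine (natDegree_smul_le _ _).trans ?_
  exact (natDegree_prod_le _ _).trans (sum_le_sum fun i _ => h _ _)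

/-- columns divisible -/
theorem prod_dvd_det {n R : Type*} [Fintype n] [DecidableEq n] [CommRing R]
    (B : Matrix n n R) (e : n → R) (h : ∀ i j, e j ∣ B i j) : ∏ j, e j ∣ det B := by
  choose q hq using h
  have : B = Matrix.of fun i j => e j * (Matrix.of q) i j := by
    ext i j; simp [← hq]
  rw [this, det_mul_row]
  exact dvd_mul_right _ _

theorem exists_minor {ι κ : Type*} [Fintype ι] [Fintype κ] [DecidableEq κ]
    (M : Matrix ι κ ℝ) (h : ∀ v : κ → ℝ, M *ᵥ v = 0 → v = 0) :
    ∃ f : κ → ι, (M.submatrix f id).det ≠ 0 := by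
  classical
  have hli : LinearIndependent ℝ M.col := by
    rw [← Matrix.mulVec_injective_iff]
    intro u v huv
    have := h (u - v) (by rw [Matrix.mulVec_sub, huv, sub_self])
    exact sub_eq_zero.mp this
  have hrank : Mᵀ.rank = Fintype.card κ := LinearIndependent.rank_matrix (M := Mᵀ) hli
  rw [rank_transpose, rank_eq_finrank_span_row] at hrank
  have htop : Submodule.span ℝ (Set.range M.row) = ⊤ := by
    apply Submodule.eq_top_of_finrank_eq
    rw [hrank]; simp
  obtain ⟨b, hb, hspan, hbli⟩ := exists_linearIndependent ℝ (Set.range M.row)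
  have hbf : b.Finite := (Set.finite_range _).subset hb
  have : Fintype b := hbf.fintype
  let B := Module.Basis.mk hbli (by simp [hspan, htop])
  have hcard : Fintype.card κ = Fintype.card b := by
    have := Module.finrank_eq_card_basis B
    simpa using this
  let e := Fintype.equivOfCardEq hcard
  choose f hf using fun x : b => hb x.2
  refine ⟨fun c => f (e c), ?_⟩
  have hli2 : LinearIndependent ℝ (M.submatrix (fun c => f (e c)) id).row := by
    have heq : (M.submatrix (fun c => f (e c)) id).row = (fun x : b => (x : κ → ℝ)) ∘ e := by
      ext c j
      have := congrFun (hf (e c)) j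
      simpa [Matrix.row] using this
    rw [heq]
    exact hbli.comp e e.injective
  rw [linearIndependent_rows_iff_isUnit, isUnit_iff_isUnit_det] at hli2
  exact hli2.ne_zero

theorem det_abs_le {n : Type*} [Fintype n] [DecidableEq n] (M : Matrix n n ℝ) (b : n → ℝ)
    (h : ∀ i j, |M i j| ≤ b i) : |M.det| ≤ (Fintype.card n).factorial * ∏ i, b i := by
  rw [← det_transpose, det_apply]
  refine (abs_sum_le_sum_abs _ _).trans ?_
  refine (sum_le_card_nsmul _ _ (∏ i, b i) fun σ _ => ?_).trans ?_
  · rw [Units.smul_def, zsmul_eq_mul, abs_mul, abs_prod]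
    have : |((Equiv.Perm.sign σ : ℤ) : ℝ)| = 1 := by
      rcases Int.units_eq_one_or (Equiv.Perm.sign σ) with h | h <;> simp [h]
    rw [this, one_mul]
    exact prod_le_prod (fun _ _ => abs_nonneg _) fun i _ => h _ _
  · simp [Fintype.card_perm]

theorem det_low_rank {n a : Type*} [Fintype n] [DecidableEq n] [Fintype a]
    (A R : Matrix n n ℝ) (Cm : Matrix n a ℝ) (V : Matrix a n ℝ) (hA : A = Cm * V)
    (hcard : 2 * Fintype.card a ≤ Fintype.card n) (b ε : ℝ) (hb : 0 ≤ b) (hε : 0 ≤ ε) (hε1 : ε ≤ 1)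
    (hAb : ∀ i j, |A i j| ≤ b) (hR : ∀ i j, |R i j| ≤ b * ε ^ 2) :
    |(A + R).det| ≤ 2 ^ Fintype.card n * ((Fintype.card n).factorial *
      (b ^ Fintype.card n * ε ^ Fintype.card n)) := by
  have key := (detRowAlternating (n := n) (R := ℝ)).toMultilinearMap.map_add_univ A R
  have key' : (A + R).det = ∑ s : Finset n, det (Matrix.of (s.piecewise A R)) := key
  rw [key']
  refine (abs_sum_le_sum_abs _ _).trans ?_
  refine (sum_le_card_nsmul _ _ ((Fintype.card n).factorial *
      (b ^ Fintype.card n * ε ^ Fintype.card n)) fun s _ => ?_).trans ?_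
  · by_cases hs : Fintype.card a < s.card
    · have : det (Matrix.of (s.piecewise A R)) = 0 := by
        by_contra hne
        have hli : LinearIndependent ℝ (Matrix.of (s.piecewise A R)).row := by
          rw [linearIndependent_rows_iff_isUnit, isUnit_iff_isUnit_det]
          exact isUnit_iff_ne_zero.mpr hne
        have h2 : LinearIndependent ℝ (fun i : s => (Matrix.of (s.piecewise A R)).row i.1) :=
          hli.comp _ Subtype.val_injective
        have h3 : LinearIndependent ℝ (A.submatrix (fun i : s => i.1) id).row := by
          convert h2 using 1
          ext i j
          simp [Matrix.row, Finset.piecewise]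
        have h4 := h3.rank_matrix
        have h5 : (A.submatrix (fun i : s => i.1) id) = (Cm.submatrix (fun i : s => i.1) id) * V := by
          rw [hA]; ext i j; simp [Matrix.mul_apply]
        rw [h5] at h4
        have h6 := (rank_mul_le_right (Cm.submatrix (fun i : s => i.1) id) V)
        have h7 := V.rank_le_card_height
        simp at h4
        omega
      rw [this, abs_zero]; positivity
    · refine (det_abs_le _ (fun i => if i ∈ s then b else b * ε ^ 2) ?_).trans ?_
      · intro i j
        by_cases hi : i ∈ s
        · simpa [hi, Finset.piecewise] using hAb i j
        · simpa [hi, Finset.piecewise] using hR i j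
      · gcongr
        rw [prod_ite]
        simp only [prod_const]
        have h1 : (univ.filter (fun i => i ∈ s)).card = s.card := by simp
        have h2 : (univ.filter (fun i => i ∉ s)).card = Fintype.card n - s.card := by
          rw [filter_not]; simp [card_univ_sdiff]
        rw [h1, h2, mul_pow, ← mul_assoc, ← pow_add, ← pow_mul]
        have h3 : s.card ≤ Fintype.card n := card_le_univ s
        rw [show s.card + (Fintype.card n - s.card) = Fintype.card n by omega]
        gcongr b ^ _ * ?_
        exact pow_le_pow_of_le_one hε hε1 (by omega)
  · simp

end LBE


namespace LBE
open Polynomial Finset Matrix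

/-- exponential power series -/
noncomputable def ex (c : ℝ) : PowerSeries ℝ := PowerSeries.rescale c (PowerSeries.exp ℝ)

theorem ex_add (a b : ℝ) : ex (a + b) = ex a * ex b := by
  simp [ex, PowerSeries.exp_mul_exp_eq_exp_add]

theorem ex_zero : ex 0 = 1 := by
  simp [ex]

theorem ex_pow (a : ℝ) (n : ℕ) : ex a ^ n = ex (n * a) := by
  induction n with
  | zero => simp [ex_zero]
  | succ n ih => rw [pow_succ, ih, ← ex_add]; congr 1; push_cast; ring

theorem ex_coeff (a : ℝ) (n : ℕ) : PowerSeries.coeff n (ex a) = a ^ n / n.factorial := by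
  simp [ex, PowerSeries.coeff_rescale, PowerSeries.coeff_exp, div_eq_mul_inv]

theorem ex_isUnit (a : ℝ) : IsUnit (ex a) :=
  IsUnit.of_mul_eq_one (ex (-a)) (by rw [← ex_add]; simp [ex_zero])

/-- multiplicity via substitution -/
theorem dvd_of_subst (P : ℝ[X]) (hP : P ≠ 0) (x θ : ℝ) (hx : x ≠ 0) (hθ : θ ≠ 0) (r : ℕ)
    (h : PowerSeries.X ^ r ∣ aeval (PowerSeries.C x * ex (-θ)) P) : (X - C x) ^ r ∣ P := by
  obtain ⟨g, hg, hgx⟩ := exists_eq_pow_rootMultiplicity_mul_and_not_dvd P hP x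
  set m := P.rootMultiplicity x
  set φ : ℝ[X] →ₐ[ℝ] PowerSeries ℝ := aeval (PowerSeries.C x * ex (-θ)) with hφ
  have hcomp : ∀ p : ℝ[X], PowerSeries.constantCoeff (φ p) = p.eval x := by
    intro p
    have : (PowerSeries.constantCoeff (R := ℝ)).comp (φ : ℝ[X] →+* PowerSeries ℝ) = evalRingHom x := by
      apply Polynomial.ringHom_ext
      · intro a
        simp [hφ, PowerSeries.algebraMap_apply]
      · have : PowerSeries.constantCoeff (ex (-θ)) = 1 := by
          have := ex_coeff (-θ) 0
          simpa using this
        simp [hφ, this]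
    exact congrArg (fun f => f p) this
  have hgu : IsUnit (φ g) := by
    rw [PowerSeries.isUnit_iff_constantCoeff, hcomp, isUnit_iff_ne_zero]
    intro h0
    exact hgx (dvd_iff_isRoot.mpr h0)
  have hX : ∃ u : PowerSeries ℝ, IsUnit u ∧ φ (X - C x) = PowerSeries.X * u := by
    have hd : PowerSeries.X ∣ φ (X - C x) := by
      rw [PowerSeries.X_dvd_iff, hcomp]; simp
    obtain ⟨u, hu⟩ := hd
    refine ⟨u, ?_, hu⟩
    rw [PowerSeries.isUnit_iff_constantCoeff, isUnit_iff_ne_zero]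
    have h1 : PowerSeries.coeff 1 (φ (X - C x)) = PowerSeries.constantCoeff u := by
      rw [hu, show (1:ℕ) = 0 + 1 from rfl, PowerSeries.coeff_succ_X_mul, PowerSeries.coeff_zero_eq_constantCoeff_apply]
    have h2 : PowerSeries.coeff 1 (φ (X - C x)) = - (x * θ) := by
      simp [hφ, ex_coeff, PowerSeries.coeff_C_mul, PowerSeries.algebraMap_apply, PowerSeries.coeff_C]
    rw [← h1, h2]
    simpa using ⟨hx, hθ⟩
  obtain ⟨u, hu, hXu⟩ := hX
  have hφP : φ P = PowerSeries.X ^ m * (u ^ m * φ g) := by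
    conv_lhs => rw [hg]
    rw [map_mul, map_pow, hXu]; ring
  rw [hφP] at h
  rw [IsUnit.dvd_mul_right ((hu.pow m).mul hgu)] at h
  have hrm : r ≤ m := by
    by_contra hlt
    push Not at hlt
    have := PowerSeries.X_pow_dvd_iff.mp h m hlt
    simp [PowerSeries.coeff_X_pow] at this
  exact (pow_dvd_pow _ hrm).trans (pow_rootMultiplicity_dvd P x)

/-- many roots with multiplicity -/
theorem mult_count (P : ℝ[X]) (hP : P ≠ 0) (pt : ℕ → ℝ) (n r : ℕ)
    (hinj : ∀ i < n, ∀ j < n, pt i = pt j → i = j)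
    (h : ∀ i < n, (X - C (pt i)) ^ r ∣ P) : n * r ≤ P.natDegree := by
  have hd : ∏ i ∈ range n, (X - C (pt i)) ^ r ∣ P := by
    apply Finset.prod_dvd_of_coprime
    · intro i hi j hj hij
      apply IsCoprime.pow
      apply isCoprime_X_sub_C_of_isUnit_sub
      rw [isUnit_iff_ne_zero, sub_ne_zero]
      intro he
      exact hij (hinj i (by simpa using hi) j (by simpa using hj) he)
    · intro i hi
      exact h i (by simpa using hi)
  have := natDegree_le_of_dvd hd hP
  rw [natDegree_prod_of_monic _ _ (fun i _ => (monic_X_sub_C _).pow r)] at this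
  simpa [natDegree_pow] using this

theorem w_inj {θ : ℝ} (hθ : Irrational θ) {a b c d : ℕ}
    (h : (b : ℝ) - θ * a = d - θ * c) : a = c ∧ b = d := by
  have h1 : θ * ((a : ℝ) - c) = b - d := by linarith
  by_cases hac : a = c
  · subst hac
    simp at h1
    refine ⟨rfl, ?_⟩
    have : (b : ℝ) = d := by linarith
    exact_mod_cast this
  · exfalso
    have hne : (a : ℝ) - c ≠ 0 := by
      rw [sub_ne_zero]; exact_mod_cast hac
    have : θ = ((b - d : ℤ) : ℝ) / ((a - c : ℤ) : ℝ) := by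
      push_cast; field_simp; linarith
    apply hθ
    refine ⟨((b - d : ℤ) : ℚ) / ((a - c : ℤ) : ℚ), ?_⟩
    rw [this]; push_cast; rfl

theorem det_scaled_vandermonde {n : ℕ} (c w : Fin n → ℝ) (hc : ∀ i, c i ≠ 0)
    (hw : Function.Injective w) :
    det (Matrix.of fun (t m : Fin n) => c m * w m ^ (t : ℕ)) ≠ 0 := by
  have : (Matrix.of fun (t m : Fin n) => c m * w m ^ (t : ℕ))
      = Matrix.of fun t m => c m * (vandermonde w)ᵀ t m := by
    ext t m; simp [vandermonde]
  rw [this, det_mul_row, det_transpose]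
  exact mul_ne_zero (prod_ne_zero_iff.mpr fun i _ => hc i) (det_vandermonde_ne_zero_iff.mpr hw)

end LBE


namespace LBE
open Polynomial Finset Matrix

theorem coeff_sum_CX (L : ℕ) (f : ℕ → ℝ) (k : ℕ) :
    (∑ i ∈ range L, C (f i) * X ^ i : ℝ[X]).coeff k = if k < L then f k else 0 := by
  simp [finsetSum_coeff, coeff_C_mul, coeff_X_pow]

theorem PZE {θ x y : ℝ} (hθ : Irrational θ) (hx : 0 < x) (hx1 : x ≠ 1) (hy : 0 < y)
    (L Kp τ : ℕ) (hK : L * L ≤ Kp * (τ - L)) (c : ℕ → ℕ → ℝ)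
    (h : ∀ σ < Kp, ∀ t < τ, ∑ i ∈ range L, ∑ j ∈ range L,
      c i j * ((j : ℝ) - θ * i) ^ t * (x ^ i * y ^ j) ^ σ = 0) :
    ∀ i < L, ∀ j < L, c i j = 0 := by
  classical
  by_contra hcon
  push Not at hcon
  obtain ⟨i0, hi0, j0, hj0, hc0⟩ := hcon
  set p : ℕ → ℝ[X] := fun j => ∑ i ∈ range L, C (c i j) * X ^ i with hp
  have hpc : ∀ j k, (p j).coeff k = if k < L then c k j else 0 := fun j k => coeff_sum_CX L _ k
  set J := (range L).filter (fun j => p j ≠ 0) with hJ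
  have hj0J : j0 ∈ J := by
    simp only [hJ, mem_filter, mem_range]
    refine ⟨hj0, fun h0 => hc0 ?_⟩
    have := hpc j0 i0
    rw [h0] at this
    simpa [hi0] using this.symm
  set n := J.card with hn
  have hn0 : 0 < n := card_pos.mpr ⟨j0, hj0J⟩
  have hnL : n ≤ L := (card_filter_le _ _).trans (by simp)
  set e := J.equivFin.symm with he
  set jm : Fin n → ℕ := fun m => (e m : ℕ) with hjm
  have hjmJ : ∀ m, jm m ∈ J := fun m => (e m).2
  have hjinj : Function.Injective jm := fun a b hab => e.injective (Subtype.ext hab)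
  set d : Fin n → ℕ := fun m => (p (jm m)).natDegree with hd
  have hdL : ∀ m, d m < L ∧ c (d m) (jm m) ≠ 0 := by
    intro m
    have h1 : p (jm m) ≠ 0 := (mem_filter.mp (hjmJ m)).2
    have h2 : (p (jm m)).coeff (d m) ≠ 0 := by
      simpa [hd] using h1
    rw [hpc] at h2
    by_cases hlt : d m < L
    · exact ⟨hlt, by simpa [hlt] using h2⟩
    · simp [hlt] at h2
  set B : Matrix (Fin n) (Fin n) ℝ[X] := Matrix.of fun t m =>
    ∑ i ∈ range L, C (c i (jm m) * ((jm m : ℝ) - θ * i) ^ (t : ℕ)) * X ^ i with hB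
  have hBc : ∀ t m k, (B t m).coeff k =
      if k < L then c k (jm m) * ((jm m : ℝ) - θ * k) ^ (t : ℕ) else 0 :=
    fun t m k => coeff_sum_CX L (fun i => c i (jm m) * ((jm m : ℝ) - θ * i) ^ (t : ℕ)) k
  have hBd : ∀ t m, (B t m).natDegree ≤ d m := by
    intro t m
    rw [natDegree_le_iff_coeff_eq_zero]
    intro N hN
    have := coeff_eq_zero_of_natDegree_lt hN
    rw [hpc] at this
    rw [hBc]
    by_cases hNL : N < L
    · simp [hNL] at this ⊢; left; exact this
    · simp [hNL]
  set Ψ := B.det with hΨ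
  have hΨ0 : Ψ ≠ 0 := by
    have h1 := coeff_det_le B d hBd
    have h2 : det (Matrix.of fun i j => (B i j).coeff (d j)) ≠ 0 := by
      have := det_scaled_vandermonde (fun m => c (d m) (jm m))
        (fun m => (jm m : ℝ) - θ * d m) (fun m => (hdL m).2)
        (fun a b hab => hjinj (w_inj hθ hab).2)
      convert this using 3
      ext t m
      simp [hBc, (hdL m).1]
    intro h0
    rw [← hΨ, h0] at h1
    exact h2 (by simpa using h1.symm)
  have hΨd : Ψ.natDegree ≤ n * (L - 1) := by
    refine (natDegree_det_le' B d hBd).trans ?_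
    refine (sum_le_card_nsmul _ _ (L - 1) fun m _ => ?_).trans (by simp)
    have := (hdL m).1
    omega
  have hdiv : ∀ σ < Kp, (X - C (x ^ σ)) ^ (τ - L) ∣ Ψ := by
    intro σ hσ
    apply dvd_of_subst Ψ hΨ0 (x ^ σ) θ (pow_ne_zero _ hx.ne') hθ.ne_zero
    set φ : ℝ[X] →ₐ[ℝ] PowerSeries ℝ := aeval (PowerSeries.C (x ^ σ) * ex (-θ)) with hφ
    set B' := φ.mapMatrix B with hB'
    have hdet : φ Ψ = B'.det := AlgHom.map_det φ B
    rw [hdet]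
    set Y : Fin n → PowerSeries ℝ := fun m => PowerSeries.C ((y ^ jm m) ^ σ) * ex (jm m) with hY
    have hBY : ∀ t, PowerSeries.X ^ (τ - L) ∣ (B' *ᵥ Y) t := by
      intro t
      rw [PowerSeries.X_pow_dvd_iff]
      intro r hr
      have h1 : (B' *ᵥ Y) t = ∑ m, ∑ i ∈ range L,
          PowerSeries.C (c i (jm m) * ((jm m : ℝ) - θ * i) ^ (t : ℕ) * (x ^ i * y ^ jm m) ^ σ) *
            ex ((jm m : ℝ) - θ * i) := by
        simp only [Matrix.mulVec, dotProduct]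
        refine sum_congr rfl fun m _ => ?_
        simp only [hB', AlgHom.mapMatrix_apply, Matrix.map_apply, hB, Matrix.of_apply, map_sum, sum_mul]
        refine sum_congr rfl fun i _ => ?_
        rw [map_mul, map_pow]
        simp only [hφ, aeval_X, aeval_C, hY, PowerSeries.algebraMap_apply, Algebra.algebraMap_self, RingHom.id_apply]
        rw [mul_pow, ex_pow, show (jm m : ℝ) - θ * i = i * (-θ) + jm m by ring, ex_add]
        simp only [mul_pow, map_mul, map_pow]
        ring
      rw [h1]
      simp only [map_sum, PowerSeries.coeff_C_mul, ex_coeff]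
      have h2 : ∀ F : ℕ → ℝ, ∑ m, F (jm m) = ∑ j ∈ J, F j := by
        intro F
        rw [← Finset.sum_coe_sort J]
        exact Equiv.sum_comp e (fun j => F j)
      rw [h2 (fun j => ∑ i ∈ range L, c i j * ((j : ℝ) - θ * i) ^ (t : ℕ) * (x ^ i * y ^ j) ^ σ *
        (((j : ℝ) - θ * i) ^ r / r.factorial))]
      have h3 := h σ hσ (t + r) (by have := t.2; omega)
      rw [sum_comm] at h3
      rw [Finset.sum_subset (filter_subset _ _ : J ⊆ range L)]
      · have h4 := congrArg (fun z => z * (r.factorial : ℝ)⁻¹) h3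
        simp only [sum_mul, zero_mul] at h4
        rw [← h4]
        refine sum_congr rfl fun j _ => sum_congr rfl fun i _ => ?_
        rw [pow_add]; ring
      · intro j hj hjJ
        have hp0 : p j = 0 := by
          by_contra hne
          exact hjJ (mem_filter.mpr ⟨hj, hne⟩)
        refine sum_eq_zero fun i hi => ?_
        have := hpc j i
        rw [hp0] at this
        simp [mem_range.mp hi] at this
        simp [← this]
    have hadj : B'.adjugate *ᵥ (B' *ᵥ Y) = B'.det • Y := by
      rw [mulVec_mulVec, adjugate_mul, smul_mulVec, one_mulVec]
    have hm := congrFun hadj ⟨0, hn0⟩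
    have hdv : PowerSeries.X ^ (τ - L) ∣ B'.det * Y ⟨0, hn0⟩ := by
      have : B'.det * Y ⟨0, hn0⟩ = (B'.adjugate *ᵥ (B' *ᵥ Y)) ⟨0, hn0⟩ := by rw [hm]; rfl
      rw [this]
      simp only [Matrix.mulVec, dotProduct]
      refine dvd_sum fun t _ => Dvd.dvd.mul_left ?_ _
      exact hBY t
    have hu : IsUnit (Y ⟨0, hn0⟩) := by
      simp only [hY]
      refine IsUnit.mul ?_ (ex_isUnit _)
      refine IsUnit.map _ ?_
      exact isUnit_iff_ne_zero.mpr (by positivity)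
    exact (IsUnit.dvd_mul_right hu).mp hdv
  have hcnt := mult_count Ψ hΨ0 (fun σ => x ^ σ) Kp (τ - L)
    (fun i _ j _ hij => pow_right_injective₀ hx hx1 hij) hdiv
  have hL0 : 0 < L := by omega
  have h1 : n * (L - 1) ≤ L * (L - 1) := Nat.mul_le_mul_right _ hnL
  have h2 : L * (L - 1) < L * L := Nat.mul_lt_mul_of_pos_left (by omega) hL0
  omega

end LBE


namespace LBE
open Polynomial Finset Matrix

theorem PZE' {θ x y : ℝ} (hθ : Irrational θ) (hx : 0 < x) (hx1 : x ≠ 1) (hy : 0 < y)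
    (L Kp τ : ℕ) (hK : L * L ≤ Kp * (τ - L)) (c : Fin L × Fin L → ℝ)
    (h : ∀ σ < Kp, ∀ t < τ, ∑ u : Fin L × Fin L,
      c u * (((u.2 : ℕ) : ℝ) - θ * ((u.1 : ℕ) : ℝ)) ^ t * (x ^ (u.1 : ℕ) * y ^ (u.2 : ℕ)) ^ σ = 0) :
    ∀ u, c u = 0 := by
  set c' : ℕ → ℕ → ℝ := fun i j => if h : i < L ∧ j < L then c (⟨i, h.1⟩, ⟨j, h.2⟩) else 0 with hc'
  have hcc : ∀ i j : Fin L, c' i j = c (i, j) := by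
    intro i j
    simp [hc']
  have := PZE hθ hx hx1 hy L Kp τ hK c' ?_
  · rintro ⟨i, j⟩
    rw [← hcc]
    exact this i i.2 j j.2
  · intro σ hσ t ht
    rw [← h σ hσ t ht, Fintype.sum_prod_type, ← Fin.sum_univ_eq_sum_range (fun i => ∑ j ∈ range L,
      c' i j * ((j : ℝ) - θ * i) ^ t * (x ^ i * y ^ j) ^ σ) L]
    refine sum_congr rfl fun i _ => ?_
    rw [← Fin.sum_univ_eq_sum_range (fun j =>
      c' i j * ((j : ℝ) - θ * (i : ℕ)) ^ t * (x ^ (i : ℕ) * y ^ j) ^ σ) L]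
    refine sum_congr rfl fun j _ => ?_
    rw [hcc]

theorem ZE {θ x y : ℝ} (hθ : Irrational θ) (hx : 0 < x) (hx1 : x ≠ 1) (hy : 0 < y)
    (L Kp τ T S L0 : ℕ) (hK : L * L ≤ Kp * (τ - L))
    (hT1 : L0 ≤ (S - Kp) * T) (hT2 : L * L * L0 ≤ (S - Kp) * (T * τ))
    (q : Fin L × Fin L → ℝ[X]) (hq : ∀ u, (q u).natDegree < L0)
    (h : ∀ s < S, ∀ t < 2 * τ, ∀ k < T, ∑ u : Fin L × Fin L,
      (hasseDeriv k (q u)).eval (s : ℝ) * (((u.2 : ℕ) : ℝ) - θ * ((u.1 : ℕ) : ℝ)) ^ t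
        * (x ^ (u.1 : ℕ) * y ^ (u.2 : ℕ)) ^ s = 0) :
    ∀ u, q u = 0 := by
  classical
  by_contra hcon
  push Not at hcon
  obtain ⟨u0, hu0⟩ := hcon
  set U := (univ : Finset (Fin L × Fin L)).filter (fun u => q u ≠ 0) with hU
  have hu0U : u0 ∈ U := mem_filter.mpr ⟨mem_univ _, hu0⟩
  set n := U.card with hn
  have hn0 : 0 < n := card_pos.mpr ⟨u0, hu0U⟩
  have hnL : n ≤ L * L := (card_filter_le _ _).trans (by simp)
  set e := U.equivFin.symm with he
  set um : Fin n → Fin L × Fin L := fun m => (e m : Fin L × Fin L) with hum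
  have humU : ∀ m, q (um m) ≠ 0 := fun m => (mem_filter.mp (e m).2).2
  have huinj : Function.Injective um := fun a b hab => e.injective (Subtype.ext hab)
  have hsumU : ∀ F : Fin L × Fin L → ℝ, ∑ m, F (um m) = ∑ u ∈ U, F u := by
    intro F
    rw [← Finset.sum_coe_sort U]
    exact Equiv.sum_comp e (fun j => F j)
  set w : Fin L × Fin L → ℝ := fun u => ((u.2 : ℕ) : ℝ) - θ * ((u.1 : ℕ) : ℝ) with hw
  set A : Fin L × Fin L → ℝ := fun u => x ^ (u.1 : ℕ) * y ^ (u.2 : ℕ) with hA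
  have hA0 : ∀ u, A u ≠ 0 := fun u => by simp only [hA]; positivity
  have hwinj : Function.Injective w := by
    intro u v huv
    obtain ⟨h1, h2⟩ := w_inj hθ huv
    exact Prod.ext (Fin.ext h1) (Fin.ext h2)
  set Mc : Matrix (Fin Kp × Fin τ) (Fin n) ℝ := Matrix.of fun r m =>
    A (um m) ^ (r.1 : ℕ) * w (um m) ^ (r.2 : ℕ) with hMc
  obtain ⟨f, hf⟩ := exists_minor Mc (by
    intro v hv
    have hz := PZE' hθ hx hx1 hy L Kp τ hK (fun u => ∑ m, if um m = u then v m else 0) (by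
      intro σ hσ t ht
      have h1 := congrFun hv (⟨σ, hσ⟩, ⟨t, ht⟩)
      simp only [Matrix.mulVec, dotProduct, hMc, Matrix.of_apply, Pi.zero_apply] at h1
      refine Eq.trans ?_ h1
      simp only [sum_mul]
      rw [sum_comm]
      refine sum_congr rfl fun m _ => ?_
      rw [Finset.sum_eq_single (um m)]
      · simp only [if_true, hA, hw]; ring
      · intro u _ hu
        simp [Ne.symm hu]
      · simp)
    funext m
    have := hz (um m)
    rw [Finset.sum_eq_single m] at this
    · simpa using this
    · intro b _ hb
      simp [huinj.ne hb]
    · simp)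
  set B : Matrix (Fin n) (Fin n) ℝ[X] := Matrix.of fun i m =>
    C (A (um m) ^ ((f i).1 : ℕ) * w (um m) ^ ((f i).2 : ℕ)) * taylor (((f i).1 : ℕ) : ℝ) (q (um m)) with hB
  set d : Fin n → ℕ := fun m => (q (um m)).natDegree with hd
  have hBd : ∀ t m, (B t m).natDegree ≤ d m := by
    intro t m
    simp only [hB, Matrix.of_apply]
    refine (natDegree_C_mul_le _ _).trans ?_
    rw [natDegree_taylor]
  set Ψ := B.det with hΨ
  have hΨ0 : Ψ ≠ 0 := by
    have h1 := coeff_det_le B d hBd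
    have h2 : det (Matrix.of fun i j => (B i j).coeff (d j)) ≠ 0 := by
      have h3 : (Matrix.of fun i j => (B i j).coeff (d j)) =
          Matrix.of fun i j => (q (um j)).leadingCoeff * (Mc.submatrix f id) i j := by
        ext i j
        simp only [hB, Matrix.of_apply, coeff_C_mul, hd, coeff_taylor_natDegree, hMc, submatrix_apply, id]
        ring
      rw [h3, det_mul_row]
      refine mul_ne_zero (prod_ne_zero_iff.mpr fun i _ => ?_) hf
      exact leadingCoeff_ne_zero.mpr (humU i)
    intro h0
    rw [← hΨ, h0] at h1
    exact h2 (by simpa using h1.symm)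
  have hΨd : Ψ.natDegree ≤ n * (L0 - 1) := by
    refine (natDegree_det_le' B d hBd).trans ?_
    refine (sum_le_card_nsmul _ _ (L0 - 1) fun m _ => ?_).trans (by simp)
    have := hq (um m)
    simp only [hd]
    omega
  have hdiv : ∀ s < S - Kp, (X - C ((s : ℕ) : ℝ)) ^ (T * min τ n) ∣ Ψ := by
    intro s hs
    set V0 : Matrix (Fin n) (Fin n) ℝ := Matrix.of fun m c => A (um m) ^ s * w (um m) ^ (c : ℕ) with hV0
    have hV0d : V0.det ≠ 0 := by
      have := det_scaled_vandermonde (fun m => A (um m) ^ s) (fun m => w (um m))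
        (fun m => pow_ne_zero _ (hA0 _)) (hwinj.comp huinj)
      rw [← det_transpose] at this
      exact this
    set V := (C : ℝ →+* ℝ[X]).mapMatrix V0 with hV
    have hVd : IsUnit V.det := by
      have : V.det = C V0.det := (RingHom.map_det C V0).symm
      rw [this]
      exact (isUnit_iff_ne_zero.mpr hV0d).map C
    have hBV : ∀ i (c : Fin n), (c : ℕ) < τ → (X - C ((s : ℕ) : ℝ)) ^ T ∣ (B * V) i c := by
      intro i c hc
      rw [X_sub_C_pow_dvd_iff, X_pow_dvd_iff]
      intro k hk
      have h1 : ((B * V) i c).comp (X + C (s : ℝ)) = taylor (s : ℝ) ((B * V) i c) := rfl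
      rw [h1, Matrix.mul_apply, map_sum, finsetSum_coeff]
      have h2 := h ((f i).1 + s) (by have := (f i).1.2; omega) ((f i).2 + c)
        (by have := (f i).2.2; omega) k hk
      rw [← Finset.sum_subset (subset_univ U), ← hsumU] at h2
      · rw [← h2]
        refine sum_congr rfl fun m _ => ?_
        simp only [hB, hV, Matrix.of_apply, RingHom.mapMatrix_apply, Matrix.map_apply, hV0, taylor_mul, taylor_C,
          taylor_taylor]
        rw [mul_comm, ← mul_assoc, ← C_mul, coeff_C_mul, taylor_coeff]
        simp only [hA, hw, pow_add]
        push_cast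
        rw [add_comm (s : ℝ)]
        ring
      · intro u _ hu
        have : q u = 0 := by
          by_contra hne
          exact hu (mem_filter.mpr ⟨mem_univ _, hne⟩)
        simp [this]
    have hp := prod_dvd_det (B * V) (fun c : Fin n => if (c : ℕ) < τ then (X - C ((s : ℕ) : ℝ)) ^ T else 1) (by
      intro i c
      by_cases hc : (c : ℕ) < τ
      · simpa only [hc, if_true] using hBV i c hc
      · simp [hc])
    rw [det_mul, IsUnit.dvd_mul_right hVd] at hp
    convert hp using 1
    rw [prod_ite]
    simp only [prod_const, one_pow, mul_one]
    rw [← pow_mul]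
    congr 2
    have := Fin.card_filter_val_lt (n := n) (m := τ)
    rw [min_comm]
    exact this.symm
  have hcnt := mult_count Ψ hΨ0 (fun s => (s : ℝ)) (S - Kp) (T * min τ n)
    (fun i _ j _ hij => by exact_mod_cast hij) hdiv
  have hcnt2 := hcnt.trans hΨd
  have hL0 : 0 < L0 := lt_of_le_of_lt (Nat.zero_le _) (hq u0)
  have hlt : n * (L0 - 1) < n * L0 := Nat.mul_lt_mul_of_pos_left (by omega) hn0
  rcases le_total n τ with hnt | hnt
  · rw [min_eq_right hnt] at hcnt2
    have : n * L0 ≤ (S - Kp) * (T * n) := by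
      calc n * L0 ≤ n * ((S - Kp) * T) := Nat.mul_le_mul_left _ hT1
        _ = _ := by ring
    omega
  · rw [min_eq_left hnt] at hcnt2
    have : n * L0 ≤ L * L * L0 := Nat.mul_le_mul_right _ hnL
    omega

end LBE


namespace LBE
open Polynomial Finset Matrix

theorem hasSum_exp' (x : ℝ) : HasSum (fun r : ℕ => x ^ r / r.factorial) (Real.exp x) := by
  rw [Real.exp_eq_exp_ℝ]
  exact NormedSpace.expSeries_div_hasSum_exp x

theorem hs1 (c s : ℝ) (l : ℕ) :
    HasSum (fun r : ℕ => c ^ r / r.factorial * (r.choose l) * s ^ (r - l))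
      (c ^ l / l.factorial * Real.exp (c * s)) := by
  have h1 := (hasSum_exp' (c * s)).mul_left (c ^ l / l.factorial)
  rw [← (add_left_injective l).hasSum_iff (f := fun r : ℕ => c ^ r / r.factorial * (r.choose l) * s ^ (r - l))]
  · convert! h1 using 1
    funext r
    simp only [Function.comp]
    have h2 : ((r + l).choose l : ℝ) = (r + l).factorial / (l.factorial * r.factorial) := by
      rw [Nat.cast_choose ℝ (Nat.le_add_left l r)]; simp
    rw [h2, Nat.add_sub_cancel, pow_add, mul_pow]
    have := Nat.factorial_ne_zero (r + l)
    field_simp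
  · intro r hr
    have : r < l := by
      by_contra hge
      push Not at hge
      exact hr ⟨r - l, by simp; omega⟩
    simp [Nat.choose_eq_zero_of_lt this]

theorem hs2 (c s : ℝ) (b j : ℕ) :
    HasSum (fun m : ℕ => (if b ≤ m then c ^ (m - b) / (m - b).factorial else 0) * (m.choose j) * s ^ (m - j))
      (∑ x ∈ antidiagonal j, (b.choose x.1) * s ^ (b - x.1) *
        (c ^ x.2 / x.2.factorial * Real.exp (c * s))) := by
  rw [← (add_left_injective b).hasSum_iff]
  · have h1 := hasSum_sum (s := antidiagonal j) (fun x _ => (hs1 c s x.2).mul_left ((b.choose x.1) * s ^ (b - x.1)))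
    convert! h1 using 1
    funext r
    simp only [Function.comp]
    rw [if_pos (Nat.le_add_left b r), Nat.add_sub_cancel, add_comm r b, Nat.add_choose_eq]
    push_cast
    rw [mul_sum, sum_mul]
    refine sum_congr rfl fun x hx => ?_
    have hxj := mem_antidiagonal.mp hx
    by_cases h1 : x.1 ≤ b
    · by_cases h2 : x.2 ≤ r
      · have : b + r - j = (b - x.1) + (r - x.2) := by omega
        rw [this, pow_add]; ring
      · simp [Nat.choose_eq_zero_of_lt (not_le.mp h2)]
    · simp [Nat.choose_eq_zero_of_lt (not_le.mp h1)]
  · intro m hm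
    have : ¬ b ≤ m := fun hge => hm ⟨m - b, by simp; omega⟩
    simp [this]

/-- Taylor coefficients of `q(z) e^{cz}` -/
noncomputable def bco (q : ℝ[X]) (c : ℝ) (m : ℕ) : ℝ :=
  ∑ b ∈ range (q.natDegree + 1), q.coeff b * (if b ≤ m then c ^ (m - b) / (m - b).factorial else 0)

noncomputable def qabs (q : ℝ[X]) (R : ℝ) : ℝ := ∑ b ∈ range (q.natDegree + 1), |q.coeff b| * R ^ b

theorem hasse_eval (q : ℝ[X]) (i : ℕ) (s : ℝ) : (hasseDeriv i q).eval s =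
    ∑ b ∈ range (q.natDegree + 1), q.coeff b * ((b.choose i) * s ^ (b - i)) := by
  rw [hasseDeriv_apply, sum_over_range]
  · simp only [eval_finsetSum, eval_monomial]
    refine sum_congr rfl fun b _ => ?_
    ring
  · simp

theorem hs3 (q : ℝ[X]) (c s : ℝ) (j : ℕ) :
    HasSum (fun m : ℕ => bco q c m * (m.choose j) * s ^ (m - j))
      (Real.exp (c * s) * ∑ x ∈ antidiagonal j, (hasseDeriv x.1 q).eval s * (c ^ x.2 / x.2.factorial)) := by
  have h1 := hasSum_sum (s := range (q.natDegree + 1)) (fun b _ => (hs2 c s b j).mul_left (q.coeff b))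
  convert! h1 using 1
  · funext m
    simp only [bco, sum_mul]
    refine sum_congr rfl fun b _ => ?_
    ring
  · simp only [hasse_eval, mul_sum, sum_mul]
    rw [sum_comm]
    refine sum_congr rfl fun b _ => sum_congr rfl fun x _ => ?_
    ring

theorem hasse_exp_id (q : ℝ[X]) (c s : ℝ) (k : ℕ) :
    (hasseDeriv k q).eval s * Real.exp (c * s) = ∑ x ∈ antidiagonal k, ((-c) ^ x.1 / x.1.factorial) *
      ∑' m : ℕ, bco q c m * (m.choose x.2) * s ^ (m - x.2) := by
  set P : PowerSeries ℝ := PowerSeries.mk fun i => (hasseDeriv i q).eval s with hP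
  have h1 : ∀ j, ∑' m : ℕ, bco q c m * (m.choose j) * s ^ (m - j) =
      Real.exp (c * s) * PowerSeries.coeff j (P * ex c) := by
    intro j
    rw [(hs3 q c s j).tsum_eq, PowerSeries.coeff_mul]
    simp [hP, ex_coeff]
  simp only [h1]
  have h2 : P = ex (-c) * (P * ex c) := by
    rw [mul_comm P, ← mul_assoc, ← ex_add]; simp [ex_zero]
  have h3 := congrArg (PowerSeries.coeff k) h2
  rw [PowerSeries.coeff_mul] at h3
  have h4 : PowerSeries.coeff k P = (hasseDeriv k q).eval s := by simp [hP]
  rw [← h4, h3, sum_mul]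
  refine sum_congr rfl fun x _ => ?_
  rw [ex_coeff]; ring

theorem choose_pow_le (m j s S : ℕ) (hs : s + 1 ≤ S) : ((m.choose j) : ℝ) * (s : ℝ) ^ (m - j) ≤ (S : ℝ) ^ m := by
  rcases le_or_gt j m with h | h
  · have h1 : s ^ (m - j) * m.choose j ≤ (s + 1) ^ m := by
      rw [add_pow]
      have := single_le_sum (f := fun i => s ^ i * 1 ^ (m - i) * m.choose i) (s := range (m + 1))
        (fun i _ => Nat.zero_le _) (a := m - j) (by simp)
      simpa [Nat.choose_symm h] using this
    have h2 : (s + 1) ^ m ≤ S ^ m := Nat.pow_le_pow_left hs m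
    have h3 : m.choose j * s ^ (m - j) ≤ S ^ m := by rw [mul_comm]; exact h1.trans h2
    exact_mod_cast h3
  · rw [Nat.choose_eq_zero_of_lt h]; simp

theorem bco_abs_hasSum (q : ℝ[X]) (c R : ℝ) :
    HasSum (fun m : ℕ => (∑ b ∈ range (q.natDegree + 1), |q.coeff b| *
      (if b ≤ m then |c| ^ (m - b) / (m - b).factorial else 0)) * R ^ m) (qabs q R * Real.exp (|c| * R)) := by
  have h1 := hasSum_sum (s := range (q.natDegree + 1)) (fun b _ => (hs2 |c| R b 0).mul_left (|q.coeff b|))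
  convert! h1 using 1
  · funext m
    simp only [sum_mul]
    refine sum_congr rfl fun b _ => ?_
    simp; ring
  · simp only [qabs, sum_mul]
    refine sum_congr rfl fun b _ => ?_
    simp; ring

theorem bco_abs_le (q : ℝ[X]) (c : ℝ) (m : ℕ) : |bco q c m| ≤ ∑ b ∈ range (q.natDegree + 1), |q.coeff b| *
      (if b ≤ m then |c| ^ (m - b) / (m - b).factorial else 0) := by
  refine (abs_sum_le_sum_abs _ _).trans (sum_le_sum fun b _ => ?_)
  rw [abs_mul]
  gcongr
  split_ifs
  · rw [abs_div, abs_pow]; simp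
  · simp

/-- weighted sums are bounded; `Y` is a set of indices on which the weight is at most `δ ρ^m`. -/
theorem wsum_bound (q : ℝ[X]) (c : ℝ) (s S j : ℕ) (hs : s + 1 ≤ S) (ρ : ℝ) (hρ : 1 ≤ ρ)
    (δ : ℝ) (g : ℕ → ℝ) (hg0 : ∀ m, |g m| ≤ |bco q c m * (m.choose j) * (s : ℝ) ^ (m - j)|)
    (hg : ∀ m, g m ≠ 0 → 1 ≤ δ * ρ ^ m) (hδ : 0 ≤ δ) :
    Summable g ∧ |∑' m, g m| ≤ δ * (qabs q (ρ * S) * Real.exp (|c| * (ρ * S))) := by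
  have h1 := (bco_abs_hasSum q c (ρ * S)).mul_left δ
  have hle : ∀ m, ‖g m‖ ≤ δ * ((∑ b ∈ range (q.natDegree + 1), |q.coeff b| *
      (if b ≤ m then |c| ^ (m - b) / (m - b).factorial else 0)) * (ρ * S) ^ m) := by
    intro m
    rw [Real.norm_eq_abs]
    have hb := bco_abs_le q c m
    set Bm := (∑ b ∈ range (q.natDegree + 1), |q.coeff b| *
      (if b ≤ m then |c| ^ (m - b) / (m - b).factorial else 0)) with hBm
    have hBm0 : 0 ≤ Bm := (abs_nonneg _).trans hb
    by_cases h0 : g m = 0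
    · rw [h0, abs_zero]; positivity
    · have h2 := hg m h0
      have h3 := choose_pow_le m j s S hs
      calc |g m| ≤ |bco q c m * (m.choose j) * (s : ℝ) ^ (m - j)| := hg0 m
        _ = |bco q c m| * ((m.choose j) * (s : ℝ) ^ (m - j)) := by
          rw [mul_assoc, abs_mul, abs_of_nonneg (a := _ * _)]; positivity
        _ ≤ Bm * (S : ℝ) ^ m := by gcongr
        _ ≤ Bm * (S : ℝ) ^ m * (δ * ρ ^ m) := le_mul_of_one_le_right (by positivity) h2
        _ = _ := by rw [mul_pow]; ring
  refine ⟨Summable.of_norm_bounded h1.summable hle, ?_⟩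
  have := tsum_of_norm_bounded h1 hle
  simpa using this

theorem sum_exp_le (c : ℝ) (k : ℕ) : ∑ x ∈ antidiagonal k, |(-c) ^ x.1 / x.1.factorial| ≤ Real.exp |c| := by
  rw [Finset.Nat.sum_antidiagonal_eq_sum_range_succ_mk]
  have h1 : ∀ i ∈ range k.succ, |(-c) ^ i / (i.factorial : ℝ)| = |c| ^ i / i.factorial := by
    intro i _
    rw [abs_div, abs_pow, abs_neg]; simp
  rw [sum_congr rfl h1]
  exact sum_le_hasSum _ (fun i _ => by positivity) (hasSum_exp' |c|)

theorem taylor_main (q : ℝ[X]) (c : ℝ) (s S k N : ℕ) (hs : s + 1 ≤ S) (ρ : ℝ) (hρ : 1 ≤ ρ) :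
    |∑ x ∈ antidiagonal k, ((-c) ^ x.1 / x.1.factorial) *
      ∑ m ∈ range N, bco q c m * (m.choose x.2) * (s : ℝ) ^ (m - x.2)| ≤
        Real.exp |c| * (qabs q (ρ * S) * Real.exp (|c| * (ρ * S))) ∧
    |(hasseDeriv k q).eval (s : ℝ) * Real.exp (c * s) - ∑ x ∈ antidiagonal k, ((-c) ^ x.1 / x.1.factorial) *
      ∑ m ∈ range N, bco q c m * (m.choose x.2) * (s : ℝ) ^ (m - x.2)| ≤
        Real.exp |c| * ((ρ⁻¹) ^ N * (qabs q (ρ * S) * Real.exp (|c| * (ρ * S)))) := by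
  have hQ : 0 ≤ qabs q (ρ * S) * Real.exp (|c| * (ρ * S)) := by
    have : 0 ≤ qabs q (ρ * S) := sum_nonneg fun b _ => by positivity
    positivity
  have gen : ∀ (F : ℕ → ℝ) (Z : ℝ), 0 ≤ Z → (∀ j, |F j| ≤ Z) →
      |∑ x ∈ antidiagonal k, ((-c) ^ x.1 / x.1.factorial) * F x.2| ≤ Real.exp |c| * Z := by
    intro F Z hZ hF
    refine (abs_sum_le_sum_abs _ _).trans ?_
    refine le_trans (sum_le_sum (g := fun x => |(-c) ^ x.1 / x.1.factorial| * Z) fun x _ => ?_) ?_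
    · rw [abs_mul]
      gcongr
      exact hF _
    · rw [← sum_mul]
      gcongr
      exact sum_exp_le c k
  constructor
  · refine gen (fun j => ∑ m ∈ range N, bco q c m * (m.choose j) * (s : ℝ) ^ (m - j)) _ hQ fun j => ?_
    set g : ℕ → ℝ := fun m => if m ∈ range N then bco q c m * (m.choose j) * (s : ℝ) ^ (m - j) else 0 with hg
    have h1 := wsum_bound q c s S j hs ρ hρ 1 g (by
      intro m
      simp only [hg]
      split_ifs
      · exact le_rfl
      · rw [abs_zero]; exact abs_nonneg _) (fun m _ => by rw [one_mul]; exact one_le_pow₀ hρ) zero_le_one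
    have h2 : ∑' m, g m = ∑ m ∈ range N, bco q c m * (m.choose j) * (s : ℝ) ^ (m - j) := by
      rw [tsum_eq_sum (s := range N)]
      · refine sum_congr rfl fun m hm => ?_
        simp only [hg, hm, if_true]
      · intro m hm
        simp only [hg, hm, if_false]
    rw [← h2]
    simpa using h1.2
  · rw [hasse_exp_id, ← sum_sub_distrib]
    simp only [← mul_sub]
    refine gen (fun j => ∑' m, bco q c m * (m.choose j) * (s : ℝ) ^ (m - j) -
      ∑ m ∈ range N, bco q c m * (m.choose j) * (s : ℝ) ^ (m - j)) _ (by positivity) fun j => ?_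
    set f : ℕ → ℝ := fun m => bco q c m * (m.choose j) * (s : ℝ) ^ (m - j) with hf
    set g : ℕ → ℝ := fun m => if m ∈ range N then 0 else f m with hg
    have hρ0 : (0 : ℝ) < ρ := by linarith
    have h1 := wsum_bound q c s S j hs ρ hρ ((ρ⁻¹) ^ N) g (by
      intro m
      simp only [hg]
      split_ifs
      · rw [abs_zero]; exact abs_nonneg _
      · exact le_rfl) (fun m hm => by
        have : N ≤ m := by
          by_contra hlt
          apply hm
          simp only [hg, mem_range, not_le.mp hlt, if_true]
        rw [inv_pow, inv_mul_eq_div, one_le_div (by positivity)]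
        exact pow_le_pow_right₀ hρ this) (by positivity)
    have hfs : Summable f := (hs3 q c s j).summable
    have h2 : ∑' m, g m = ∑' m, f m - ∑ m ∈ range N, f m := by
      have h3 : ∀ m, g m = f m - (if m ∈ range N then f m else 0) := by
        intro m
        simp only [hg]
        split_ifs <;> simp
      have h4 : Summable fun m => if m ∈ range N then f m else 0 :=
        summable_of_ne_finset_zero (s := range N) (by intro m hm; simp only [hm, if_false])
      rw [tsum_congr h3, hfs.tsum_sub h4, tsum_eq_sum (s := range N) (f := fun m => if m ∈ range N then f m else 0)]
      · congr 1
        refine sum_congr rfl fun m hm => ?_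
        simp only [hm, if_true]
      · intro m hm
        simp only [hm, if_false]
    rw [← h2]
    exact h1.2

end LBE


namespace LBE
open Polynomial Finset Matrix

theorem liou (ϑ : ℝ) (hϑ : IsIntegral ℤ ϑ) : ∃ R : ℝ, 1 ≤ R ∧ ∃ d : ℕ, ∀ Q : ℤ[X], aeval ϑ Q ≠ 0 →
    ∀ B : ℝ, 1 ≤ B → (∀ z : ℂ, ‖z‖ ≤ R → ‖aeval z Q‖ ≤ B) → 1 ≤ |aeval ϑ Q| * B ^ d := by
  classical
  have hInt : IsIntegral ℚ ϑ := hϑ.tower_top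
  have : FiniteDimensional ℚ (IntermediateField.adjoin ℚ {ϑ}) :=
    IntermediateField.adjoin.finiteDimensional hInt
  set K := IntermediateField.adjoin ℚ {ϑ} with hK
  set γ : K := IntermediateField.AdjoinSimple.gen ℚ ϑ with hγ
  have hγϑ : algebraMap K ℝ γ = ϑ := IntermediateField.AdjoinSimple.algebraMap_gen ℚ ϑ
  have hγint : IsIntegral ℤ γ := by
    rw [← hγϑ] at hϑ
    exact (isIntegral_algebraMap_iff (algebraMap K ℝ).injective).mp hϑ
  set σ0 : K →ₐ[ℚ] ℂ := (Complex.ofRealAm.restrictScalars ℚ).comp (IsScalarTower.toAlgHom ℚ K ℝ) with hσ0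
  refine ⟨1 + ∑ σ : K →ₐ[ℚ] ℂ, ‖σ γ‖, ?_, Fintype.card (K →ₐ[ℚ] ℂ), ?_⟩
  · have : 0 ≤ ∑ σ : K →ₐ[ℚ] ℂ, ‖σ γ‖ := sum_nonneg fun _ _ => norm_nonneg _
    linarith
  intro Q hQ B hB hz
  set x : K := aeval γ Q with hx
  have hxσ : ∀ σ : K →ₐ[ℚ] ℂ, σ x = aeval (σ γ) Q := by
    intro σ
    have := (Polynomial.aeval_algHom_apply (σ.restrictScalars ℤ) γ Q)
    exact this.symm
  have hx0 : σ0 x = ((aeval ϑ Q : ℝ) : ℂ) := by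
    have h1 : algebraMap K ℝ x = aeval ϑ Q := by
      rw [hx, ← hγϑ, aeval_algebraMap_apply]
    have : σ0 x = ((algebraMap K ℝ x : ℝ) : ℂ) := rfl
    rw [this, h1]
  have hxne : x ≠ 0 := by
    intro h
    rw [h, map_zero] at hx0
    exact hQ (by exact_mod_cast hx0.symm)
  have hxint : IsIntegral ℤ x := by
    have h1 : x ∈ Algebra.adjoin ℤ {γ} := aeval_mem_adjoin_singleton ℤ γ
    exact adjoin_le_integralClosure hγint h1
  have hnint : IsIntegral ℤ (Algebra.norm ℚ x) := Algebra.isIntegral_norm ℚ hxint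
  obtain ⟨z, hzz⟩ := IsIntegrallyClosed.isIntegral_iff.mp hnint
  have hn0 : Algebra.norm ℚ x ≠ 0 := Algebra.norm_ne_zero_iff.mpr hxne
  have hprod := Algebra.norm_eq_prod_embeddings ℚ ℂ (x := x)
  have hz1 : (1 : ℝ) ≤ ‖(algebraMap ℚ ℂ) (Algebra.norm ℚ x)‖ := by
    rw [← hzz]
    have hz0 : z ≠ 0 := by
      rintro rfl
      apply hn0; rw [← hzz]; simp
    have : (1 : ℤ) ≤ |z| := Int.one_le_abs hz0
    simp
    exact_mod_cast this
  rw [hprod, norm_prod] at hz1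
  rw [← Finset.mul_prod_erase _ _ (mem_univ σ0), hx0] at hz1
  refine hz1.trans ?_
  rw [Complex.norm_real, Real.norm_eq_abs]
  gcongr
  refine le_trans (prod_le_prod (g := fun _ => B) (fun _ _ => norm_nonneg _) fun σ _ => ?_) (by
    rw [prod_const]; exact pow_le_pow_right₀ hB (card_le_univ _))
  rw [hxσ]
  apply hz
  have := single_le_sum (f := fun σ : K →ₐ[ℚ] ℂ => ‖σ γ‖) (fun _ _ => norm_nonneg _) (mem_univ σ)
  linarith

end LBE


namespace LBE
open Polynomial Finset Matrix

/-- integer-coefficient real polynomials -/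
noncomputable abbrev ZL : Subsemiring ℝ[X] := lifts (Int.castRingHom ℝ)

theorem ZL_C (z : ℤ) : (C (z : ℝ)) ∈ ZL := by
  rw [mem_lifts]; exact ⟨C z, by simp⟩

theorem ZL_X : (X : ℝ[X]) ∈ ZL := by
  rw [mem_lifts]; exact ⟨X, by simp⟩

theorem ZL_lin (a b : ℤ) : (C (a : ℝ) * X + C (b : ℝ)) ∈ ZL :=
  ZL.add_mem (ZL.mul_mem (ZL_C a) ZL_X) (ZL_C b)

/-- binomial polynomials -/
noncomputable def bp (i : ℕ) : ℝ[X] := C ((i.factorial : ℝ)⁻¹) * descPochhammer ℝ i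

theorem bp_zero : bp 0 = 1 := by simp [bp]

theorem dP_prod (i : ℕ) : ∃ R : ℝ[X], descPochhammer ℝ (i + 1) = C (i.factorial : ℝ) * X * R ∧
    ∀ d S : ℕ, i ≤ S → (∀ l, 1 ≤ l → l ≤ S → l ∣ d) → R.comp (C (d : ℝ) * X) ∈ ZL := by
  induction i with
  | zero => exact ⟨1, by simp, fun d S _ _ => by simpa using ZL.one_mem⟩
  | succ i ih =>
    obtain ⟨R, hR, hRZ⟩ := ih
    refine ⟨R * (C (((i + 1 : ℕ) : ℝ)⁻¹) * X - 1), ?_, ?_⟩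
    · rw [descPochhammer_succ_right, hR]
      have h1 : (X - ((i + 1 : ℕ) : ℝ[X])) = C ((i + 1 : ℕ) : ℝ) * (C (((i + 1 : ℕ) : ℝ)⁻¹) * X - 1) := by
        rw [mul_sub, ← mul_assoc, ← C_mul, mul_inv_cancel₀ (by positivity)]
        simp
      rw [h1, Nat.factorial_succ]
      push_cast
      simp only [C_mul]
      ring
    · intro d S hi hd
      rw [mul_comp]
      refine ZL.mul_mem (hRZ d S (by omega) hd) ?_
      obtain ⟨e, he⟩ := hd (i + 1) (by omega) hi
      have : (C (((i + 1 : ℕ) : ℝ)⁻¹) * X - 1 : ℝ[X]).comp (C (d : ℝ) * X)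
          = C ((e : ℤ) : ℝ) * X + C (((-1 : ℤ)) : ℝ) := by
        rw [sub_comp, mul_comp, C_comp, X_comp, one_comp, he, ← mul_assoc, ← C_mul]
        have : ((i + 1 : ℕ) : ℝ)⁻¹ * (((i + 1) * e : ℕ) : ℝ) = ((e : ℤ) : ℝ) := by
          push_cast; field_simp
        rw [this]; simp; ring
      rw [this]
      exact ZL_lin _ _

theorem bp_pascal (i : ℕ) : (bp (i + 1)).comp (X + 1) = bp (i + 1) + bp i := by
  have h1 : (descPochhammer ℝ (i + 1)).comp (X + 1) = (X + 1) * descPochhammer ℝ i := by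
    rw [descPochhammer_succ_left, mul_comp, X_comp, comp_assoc]
    simp
  have h2 : C (((i + 1).factorial : ℝ)⁻¹) * ((i : ℝ[X]) + 1) = C ((i.factorial : ℝ)⁻¹) := by
    rw [show ((i : ℝ[X]) + 1) = C ((i : ℝ) + 1) by simp, ← C_mul, Nat.factorial_succ]
    congr 1; push_cast
    have := Nat.factorial_ne_zero i
    field_simp
  simp only [bp]
  rw [mul_comp, C_comp, h1, descPochhammer_succ_right, ← h2]
  ring

theorem bp_good (d S : ℕ) (hd : ∀ l, 1 ≤ l → l ≤ S → l ∣ d) (s : ℕ) :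
    ∀ i ≤ S, (bp i).comp (C (d : ℝ) * X + C (s : ℝ)) ∈ ZL := by
  induction s with
  | zero =>
    intro i hi
    cases i with
    | zero => rw [bp_zero]; simpa using ZL.one_mem
    | succ i =>
      obtain ⟨R, hR, hRZ⟩ := dP_prod i
      obtain ⟨e, he⟩ := hd (i + 1) (by omega) hi
      have h1 : bp (i + 1) = C (((i + 1 : ℕ) : ℝ)⁻¹) * X * R := by
        rw [bp, hR, Nat.factorial_succ, ← mul_assoc, ← mul_assoc, ← C_mul]
        congr 3; push_cast
        have := Nat.factorial_ne_zero i
        field_simp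
      have h2 : (bp (i + 1)).comp (C (d : ℝ) * X + C ((0 : ℕ) : ℝ)) =
          (C ((e : ℤ) : ℝ) * X + C (((0 : ℤ)) : ℝ)) * R.comp (C (d : ℝ) * X) := by
        rw [h1]
        simp only [Nat.cast_zero, C_0, add_zero, mul_comp, C_comp, X_comp, Int.cast_zero]
        congr 1
        rw [← mul_assoc, ← C_mul, he]
        congr 2; push_cast; field_simp
      rw [h2]
      exact ZL.mul_mem (ZL_lin _ _) (hRZ d S (by omega) hd)
  | succ s ih =>
    intro i hi
    cases i with
    | zero => rw [bp_zero]; simpa using ZL.one_mem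
    | succ i =>
      have h1 : (bp (i + 1)).comp (C (d : ℝ) * X + C ((s + 1 : ℕ) : ℝ)) =
          ((bp (i + 1)).comp (X + 1)).comp (C (d : ℝ) * X + C (s : ℝ)) := by
        rw [comp_assoc]; congr 1; simp; ring
      rw [h1, bp_pascal, add_comp]
      exact ZL.add_mem (ih _ hi) (ih _ (by omega))

/-- the basis -/
noncomputable def qn (S n : ℕ) : ℝ[X] := bp S ^ (n / S) * X ^ (n % S)

theorem qn_int (d S : ℕ) (hd : ∀ l, 1 ≤ l → l ≤ S → l ∣ d) (n k s T : ℕ) (hk : k ≤ T) :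
    ∃ z : ℤ, (d : ℝ) ^ T * (hasseDeriv k (qn S n)).eval (s : ℝ) = z := by
  have h1 : (qn S n).comp (C (d : ℝ) * X + C (s : ℝ)) ∈ ZL := by
    rw [qn, mul_comp, pow_comp, pow_comp, X_comp]
    refine ZL.mul_mem (ZL.pow_mem (bp_good d S hd s S le_rfl) _) (ZL.pow_mem ?_ _)
    exact_mod_cast ZL_lin d s
  have h2 : (qn S n).comp (C (d : ℝ) * X + C (s : ℝ)) = (taylor (s : ℝ) (qn S n)).comp (C (d : ℝ) * X) := by
    rw [taylor_apply, comp_assoc]; simp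
  rw [h2, lifts_iff_coeff_lifts] at h1
  obtain ⟨z, hz⟩ := h1 k
  rw [comp_C_mul_X_coeff, taylor_coeff] at hz
  refine ⟨(d : ℤ) ^ (T - k) * z, ?_⟩
  push_cast
  simp only [eq_intCast] at hz
  have h3 : (d : ℝ) ^ T = (d : ℝ) ^ (T - k) * (d : ℝ) ^ k := by
    rw [← pow_add]; congr 1; omega
  rw [hz, h3]; ring

theorem bp_natDegree (S : ℕ) : (bp S).natDegree = S := by
  rw [bp, natDegree_C_mul (by positivity), descPochhammer_natDegree]

theorem bp_ne_zero (S : ℕ) : bp S ≠ 0 := by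
  rw [bp]
  exact mul_ne_zero (by simp [Nat.factorial_ne_zero]) (monic_descPochhammer ℝ S).ne_zero

theorem qn_ne_zero (S n : ℕ) : qn S n ≠ 0 :=
  mul_ne_zero (pow_ne_zero _ (bp_ne_zero S)) (pow_ne_zero _ X_ne_zero)

theorem qn_natDegree (S n : ℕ) : (qn S n).natDegree = n := by
  rw [qn, natDegree_mul (pow_ne_zero _ (bp_ne_zero S)) (pow_ne_zero _ X_ne_zero), natDegree_pow, natDegree_pow,
    bp_natDegree, natDegree_X, mul_one, mul_comm]
  exact Nat.div_add_mod n S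

theorem qn_indep (S N : ℕ) (v : Fin N → ℝ) (h : ∑ n : Fin N, C (v n) * qn S n = 0) : v = 0 := by
  let sq : Polynomial.Sequence ℝ := ⟨qn S, fun i => by
    rw [degree_eq_natDegree (qn_ne_zero S i), qn_natDegree]⟩
  have hli := sq.linearIndependent
  have h2 : LinearIndependent ℝ (fun n : Fin N => qn S n) := hli.comp (fun n : Fin N => (n : ℕ)) Fin.val_injective
  rw [Fintype.linearIndependent_iff] at h2
  funext n
  refine h2 v ?_ n
  simpa [smul_eq_C_mul] using h

theorem qabs_eq (q : ℝ[X]) (R : ℝ) (N : ℕ) (hN : q.natDegree < N) :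
    qabs q R = ∑ b ∈ range N, |q.coeff b| * R ^ b := by
  rw [qabs]
  refine sum_subset (fun b hb => by simp at hb ⊢; omega) fun b _ hb => ?_
  rw [coeff_eq_zero_of_natDegree_lt (by simp at hb; omega)]; simp

noncomputable def absP (q : ℝ[X]) : ℝ[X] := ∑ b ∈ range (q.natDegree + 1), C |q.coeff b| * X ^ b

theorem absP_coeff (q : ℝ[X]) (k : ℕ) : (absP q).coeff k = |q.coeff k| := by
  rw [absP, coeff_sum_CX]
  split_ifs with h
  · rfl
  · rw [coeff_eq_zero_of_natDegree_lt (by omega), abs_zero]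

theorem absP_eval (q : ℝ[X]) (R : ℝ) : (absP q).eval R = qabs q R := by
  simp [absP, qabs, eval_finsetSum]

theorem qabs_nonneg (q : ℝ[X]) {R : ℝ} (hR : 0 ≤ R) : 0 ≤ qabs q R :=
  sum_nonneg fun b _ => by positivity

theorem qabs_mul (p q : ℝ[X]) {R : ℝ} (hR : 0 ≤ R) : qabs (p * q) R ≤ qabs p R * qabs q R := by
  rw [← absP_eval p, ← absP_eval q, ← eval_mul]
  set N := max (p * q).natDegree (absP p * absP q).natDegree + 1 with hN
  rw [qabs_eq _ _ N (by omega), eval_eq_sum_range' (n := N) (by omega)]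
  refine sum_le_sum fun b _ => ?_
  gcongr
  rw [coeff_mul, coeff_mul]
  refine (abs_sum_le_sum_abs _ _).trans (le_of_eq ?_)
  refine sum_congr rfl fun x _ => ?_
  rw [abs_mul, absP_coeff, absP_coeff]

theorem qabs_C (a R : ℝ) : qabs (C a) R = |a| := by simp [qabs]
theorem qabs_X_le (R : ℝ) : qabs X R = R := by simp [qabs, sum_range_succ]

theorem qabs_pow (p : ℝ[X]) {R : ℝ} (hR : 0 ≤ R) (n : ℕ) : qabs (p ^ n) R ≤ qabs p R ^ n := by
  induction n with
  | zero => simp [qabs]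
  | succ n ih =>
    rw [pow_succ, pow_succ]
    refine (qabs_mul _ _ hR).trans ?_
    gcongr
    exact qabs_nonneg _ hR

theorem qabs_dP (i : ℕ) {R : ℝ} (hR : 0 ≤ R) : qabs (descPochhammer ℝ i) R ≤ (R + i) ^ i := by
  induction i with
  | zero => simp [qabs]
  | succ i ih =>
    rw [descPochhammer_succ_right]
    refine (qabs_mul _ _ hR).trans ?_
    have h1 : qabs (X - (i : ℝ[X])) R ≤ R + i := by
      rw [qabs_eq _ _ 2 (by rw [← C_eq_natCast, natDegree_X_sub_C]; omega)]
      simp [sum_range_succ, coeff_natCast_ite, coeff_X]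
      linarith
    rw [pow_succ]
    push_cast
    have h0 := qabs_nonneg (descPochhammer ℝ i) hR
    have h2 := qabs_nonneg (X - (i : ℝ[X])) hR
    calc _ ≤ (R + i) ^ i * (R + i) := by gcongr
      _ ≤ _ := by gcongr <;> linarith

theorem qabs_bp (S : ℕ) (hS : 1 ≤ S) {ρ : ℝ} (hρ : 0 ≤ ρ) :
    qabs (bp S) (ρ * S) ≤ (Real.exp 1 * (ρ + 1)) ^ S := by
  have hR : 0 ≤ ρ * S := by positivity
  refine (qabs_mul _ _ hR).trans ?_
  rw [qabs_C, abs_of_nonneg (by positivity)]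
  have h1 := qabs_dP S hR
  have h2 : (S : ℝ) ^ S / S.factorial ≤ Real.exp S := Real.pow_div_factorial_le_exp S (by positivity) S
  calc _ ≤ (S.factorial : ℝ)⁻¹ * (ρ * S + S) ^ S := by gcongr
    _ = (S : ℝ) ^ S / S.factorial * (ρ + 1) ^ S := by
      rw [show ρ * S + S = S * (ρ + 1) by ring, mul_pow]; ring
    _ ≤ Real.exp S * (ρ + 1) ^ S := by gcongr
    _ = _ := by rw [mul_pow, ← Real.exp_nat_mul, mul_one]

theorem qabs_qn (S E n : ℕ) (hS : 1 ≤ S) (hn : n < E * S) {ρ : ℝ} (hρ : 1 ≤ ρ) :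
    qabs (qn S n) (ρ * S) ≤ (Real.exp 1 * (ρ + 1)) ^ (E * S) * (ρ * S) ^ S := by
  have hS' : (1 : ℝ) ≤ S := by exact_mod_cast hS
  have hR1 : 1 ≤ ρ * S := one_le_mul_of_one_le_of_one_le hρ hS'
  have hR : 0 ≤ ρ * S := by linarith
  have he : 1 ≤ Real.exp 1 * (ρ + 1) :=
    one_le_mul_of_one_le_of_one_le (Real.one_le_exp zero_le_one) (by linarith)
  refine (qabs_mul _ _ hR).trans ?_
  have h1 := qabs_pow (bp S) hR (n / S)
  have h2 := qabs_pow X hR (n % S)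
  have h3 := qabs_bp S hS (by linarith : 0 ≤ ρ)
  rw [qabs_X_le] at h2
  have h4 : n / S ≤ E := (Nat.div_lt_of_lt_mul (by rwa [mul_comm])).le
  have h5 : n % S ≤ S := (Nat.mod_lt _ (by omega)).le
  have h0 := qabs_nonneg (bp S) hR
  gcongr
  · exact qabs_nonneg _ hR
  · calc _ ≤ qabs (bp S) (ρ * S) ^ (n / S) := h1
      _ ≤ ((Real.exp 1 * (ρ + 1)) ^ S) ^ (n / S) := by gcongr
      _ = (Real.exp 1 * (ρ + 1)) ^ (S * (n / S)) := by rw [pow_mul]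
      _ ≤ _ := pow_le_pow_right₀ he (by rw [mul_comm]; exact Nat.mul_le_mul_right _ h4)
  · exact h2.trans (pow_le_pow_right₀ hR1 h5)

theorem hasse_abs_le (q : ℝ[X]) (k s S : ℕ) (hs : s + 1 ≤ S) :
    |(hasseDeriv k q).eval (s : ℝ)| ≤ qabs q S := by
  rw [hasse_eval]
  refine (abs_sum_le_sum_abs _ _).trans (sum_le_sum fun b _ => ?_)
  rw [abs_mul]
  have h1 : (0 : ℝ) ≤ (b.choose k) * (s : ℝ) ^ (b - k) := by positivity
  rw [abs_of_nonneg h1]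
  gcongr
  exact choose_pow_le b k s S hs

theorem lcm_exists (S : ℕ) : ∃ d : ℕ, 1 ≤ d ∧ (∀ l, 1 ≤ l → l ≤ S → l ∣ d) ∧ (d : ℝ) ≤ Real.exp (6 * S) := by
  refine ⟨Nat.lcmUpto S, Nat.lcmUpto_pos S, ?_, ?_⟩
  · intro l h1 h2
    exact Finset.dvd_lcm (f := id) (by simp; omega)
  · have h1 := Chebyshev.psi_eq_log_lcmUpto S
    have h2 := Chebyshev.psi_le_const_mul_self (x := (S : ℝ)) (by positivity)
    rw [h1] at h2
    have hpos : (0 : ℝ) < Nat.lcmUpto S := by exact_mod_cast Nat.lcmUpto_pos S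
    rw [← Real.log_le_iff_le_exp hpos]
    refine h2.trans ?_
    have : Real.log 4 ≤ 2 := by
      rw [show (4 : ℝ) = 2 ^ 2 by norm_num, Real.log_pow]
      have := Real.log_two_lt_d9
      push_cast; linarith
    gcongr
    linarith

end LBE


namespace LBE
open Polynomial Finset Matrix

/-- the frequencies -/
noncomputable def ww (θ : ℝ) {L : ℕ} (u : Fin L × Fin L) : ℝ := ((u.2 : ℕ) : ℝ) - θ * ((u.1 : ℕ) : ℝ)

/-- the multipliers -/
noncomputable def AA (x y : ℝ) {L : ℕ} (u : Fin L × Fin L) : ℝ := x ^ (u.1 : ℕ) * y ^ (u.2 : ℕ)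

/-- the interpolation matrix -/
noncomputable def MM (θ x y : ℝ) (T S N0 L : ℕ) :
    Matrix (Fin T × Fin T × Fin S) (Fin N0 × (Fin L × Fin L)) ℝ :=
  Matrix.of fun r c => (hasseDeriv (r.1 : ℕ) (qn S c.1)).eval ((r.2.2 : ℕ) : ℝ) *
    ww θ c.2 ^ (r.2.1 : ℕ) * AA x y c.2 ^ (r.2.2 : ℕ)

theorem MM_minor {θ x y : ℝ} (hθ : Irrational θ) (hx : 0 < x) (hx1 : x ≠ 1) (hy : 0 < y)
    (L Kp τ S L0 : ℕ) (hK : L * L ≤ Kp * (τ - L)) (hL0 : 0 < L0)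
    (hT1 : L0 ≤ (S - Kp) * (2 * τ)) (hT2 : L * L * L0 ≤ (S - Kp) * (2 * τ * τ)) :
    ∃ f, ((MM θ x y (2 * τ) S L0 L).submatrix f id).det ≠ 0 := by
  classical
  apply exists_minor
  intro v hv
  have hz := ZE hθ hx hx1 hy L Kp τ (2 * τ) S L0 hK hT1 hT2
    (fun u => ∑ n : Fin L0, C (v (n, u)) * qn S n) (by
      intro u
      have : (∑ n : Fin L0, C (v (n, u)) * qn S n).natDegree ≤ L0 - 1 := by
        refine natDegree_sum_le_of_forall_le _ _ fun n _ => (natDegree_C_mul_le _ _).trans ?_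
        rw [qn_natDegree]
        have := n.2
        omega
      omega) (by
      intro s hs t ht k hk
      have h1 := congrFun hv (⟨k, hk⟩, ⟨t, ht⟩, ⟨s, hs⟩)
      simp only [Matrix.mulVec, dotProduct, MM, Matrix.of_apply, Pi.zero_apply] at h1
      refine Eq.trans ?_ h1
      refine Eq.trans ?_ (Fintype.sum_prod_type_right _).symm
      refine sum_congr rfl fun u _ => ?_
      rw [map_sum, eval_finsetSum, sum_mul, sum_mul]
      refine sum_congr rfl fun n _ => ?_
      rw [← smul_eq_C_mul, map_smul, eval_smul, smul_eq_mul, ww, AA]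
      ring)
  funext ⟨n, u⟩
  have := qn_indep S L0 (fun n => v (n, u)) (hz u)
  exact congrFun this n

theorem qabs_mono (q : ℝ[X]) {R R' : ℝ} (hR : 0 ≤ R) (h : R ≤ R') : qabs q R ≤ qabs q R' := by
  unfold qabs
  gcongr

theorem det_upper {θ x y : ℝ} (hx : 0 < x) (hy : 0 < y) (T S N0 L X' : ℕ)
    (hcard : 2 * (2 * T * (2 * X')) ≤ N0 * (L * L))
    (ρ W H Bq : ℝ) (hρ : 1 ≤ ρ) (hW : 1 ≤ W) (hw : ∀ u : Fin L × Fin L, |ww θ u| ≤ W)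
    (hH : |Real.log y| ≤ H) (hBq : ∀ n < N0, qabs (qn S n) (ρ * S) ≤ Bq) (hBq0 : 0 ≤ Bq)
    (hΛ : 2 * (L * S * |Real.log x + θ * Real.log y|) ≤ (ρ⁻¹) ^ (2 * X'))
    (f : Fin N0 × (Fin L × Fin L) → Fin T × Fin T × Fin S) :
    |((MM θ x y T S N0 L).submatrix f id).det| ≤ 2 ^ (N0 * (L * L)) * ((N0 * (L * L)).factorial *
      ((2 * (W ^ T * (Real.exp (H * W) * (Bq * Real.exp (H * W * (ρ * S)))))) ^ (N0 * (L * L)) *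
        ((ρ⁻¹) ^ X') ^ (N0 * (L * L)))) := by
  classical
  set ℓ := Real.log y with hℓ
  set Λ := Real.log x + θ * ℓ with hΛd
  set B0 := W ^ T * (Real.exp (H * W) * (Bq * Real.exp (H * W * (ρ * S)))) with hB0
  have hH0 : 0 ≤ H := (abs_nonneg _).trans hH
  have hW0 : 0 ≤ W := by linarith
  have hB00 : 0 ≤ B0 := by positivity
  have hρ0 : 0 < ρ := by linarith
  have hρi : ρ⁻¹ ≤ 1 := inv_le_one_of_one_le₀ hρ
  set Cm0 : Matrix (Fin T × Fin T × Fin S) (Fin (2 * T) × Fin (2 * X')) ℝ := Matrix.of fun r a =>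
    ∑ z ∈ antidiagonal (r.1 : ℕ), if (r.2.1 : ℕ) + z.1 = (a.1 : ℕ) then
      (-ℓ) ^ z.1 / z.1.factorial * (((a.2 : ℕ).choose z.2) * ((r.2.2 : ℕ) : ℝ) ^ ((a.2 : ℕ) - z.2)) else 0 with hCm0
  set V : Matrix (Fin (2 * T) × Fin (2 * X')) (Fin N0 × (Fin L × Fin L)) ℝ := Matrix.of fun a c =>
    ww θ c.2 ^ (a.1 : ℕ) * bco (qn S c.1) (ℓ * ww θ c.2) a.2 with hV
  have hCV : ∀ r c, (Cm0 * V) r c = ww θ c.2 ^ (r.2.1 : ℕ) *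
      ∑ z ∈ antidiagonal (r.1 : ℕ), ((-(ℓ * ww θ c.2)) ^ z.1 / z.1.factorial) *
      ∑ m ∈ range (2 * X'), bco (qn S c.1) (ℓ * ww θ c.2) m * (m.choose z.2) *
        ((r.2.2 : ℕ) : ℝ) ^ (m - z.2) := by
    rintro ⟨k, t, s⟩ ⟨n, u⟩
    simp only [Matrix.mul_apply, hCm0, hV, Matrix.of_apply, sum_mul, mul_sum]
    rw [sum_comm]
    refine sum_congr rfl fun z hz => ?_
    rw [Fintype.sum_prod_type, sum_comm]
    rw [← Fin.sum_univ_eq_sum_range (fun m => ww θ u ^ (t : ℕ) * ((-(ℓ * ww θ u)) ^ z.1 / (z.1.factorial : ℝ) *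
      (bco (qn S n) (ℓ * ww θ u) m * (m.choose z.2) * ((s : ℕ) : ℝ) ^ (m - z.2))))]
    refine sum_congr rfl fun m _ => ?_
    have hzk := mem_antidiagonal.mp hz
    have hlt : (t : ℕ) + z.1 < 2 * T := by
      have := t.2; have := k.2; omega
    rw [Finset.sum_eq_single (⟨(t : ℕ) + z.1, hlt⟩ : Fin (2 * T))]
    · simp only [if_true]
      rw [pow_add, neg_mul_eq_neg_mul, mul_pow]
      ring
    · intro b _ hb
      have : ¬ ((t : ℕ) + z.1 = (b : ℕ)) := fun h => hb (Fin.ext h.symm)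
      simp [this]
    · simp
  have hexp : ∀ (u : Fin L × Fin L) (s : ℕ), AA x y u ^ s =
      Real.exp (ℓ * ww θ u * s) * Real.exp ((u.1 : ℕ) * Λ * s) := by
    intro u s
    rw [← Real.exp_add, show ℓ * ww θ u * s + (u.1 : ℕ) * Λ * s =
      (s : ℝ) * ((u.1 : ℕ) * Real.log x + (u.2 : ℕ) * Real.log y) by rw [ww, hΛd, hℓ]; ring]
    rw [Real.exp_nat_mul, Real.exp_add, Real.exp_nat_mul, Real.exp_nat_mul, Real.exp_log hx, Real.exp_log hy, AA]
  have hc : ∀ u : Fin L × Fin L, |ℓ * ww θ u| ≤ H * W := by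
    intro u
    rw [abs_mul]
    exact mul_le_mul hH (hw u) (abs_nonneg _) hH0
  have hwt : ∀ (u : Fin L × Fin L) (t : Fin T), |ww θ u ^ (t : ℕ)| ≤ W ^ T := by
    intro u t
    rw [abs_pow]
    calc _ ≤ W ^ (t : ℕ) := by gcongr; exact hw u
      _ ≤ W ^ T := pow_le_pow_right₀ hW t.2.le
  have hAb : ∀ r c, |(Cm0 * V) r c| ≤ B0 := by
    rintro ⟨k, t, s⟩ ⟨n, u⟩
    rw [hCV, abs_mul]
    have h1 := (taylor_main (qn S n) (ℓ * ww θ u) s S k (2 * X') s.2 ρ hρ).1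
    have h2 := hBq n n.2
    have h3 := hc u
    have h0 := qabs_nonneg (qn S n) (R := ρ * S) (by positivity)
    simp only
    refine mul_le_mul (hwt u t) (h1.trans ?_) (abs_nonneg _) (by positivity)
    gcongr
  have hR : ∀ r c, |MM θ x y T S N0 L r c - (Cm0 * V) r c| ≤ 2 * B0 * ((ρ⁻¹) ^ X') ^ 2 := by
    rintro ⟨k, t, s⟩ ⟨n, u⟩
    have h1 := (taylor_main (qn S n) (ℓ * ww θ u) s S k (2 * X') s.2 ρ hρ).2
    have h2 := hBq n n.2
    have h3 := hc u
    have h0 := qabs_nonneg (qn S n) (R := ρ * S) (by positivity)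
    rw [hCV]
    simp only [MM, Matrix.of_apply]
    rw [hexp]
    set app := ∑ z ∈ antidiagonal (k : ℕ), ((-(ℓ * ww θ u)) ^ z.1 / z.1.factorial) *
      ∑ m ∈ range (2 * X'), bco (qn S n) (ℓ * ww θ u) m * (m.choose z.2) *
        ((s : ℕ) : ℝ) ^ (m - z.2) with happ
    set hd := (hasseDeriv (k : ℕ) (qn S n)).eval ((s : ℕ) : ℝ) with hhd
    have hs1 : (1 : ℝ) ≤ S := by
      have : 1 ≤ S := by have := s.2; omega
      exact_mod_cast this
    have hdb : |hd| ≤ Bq := by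
      refine (hasse_abs_le (qn S n) k s S s.2).trans (le_trans ?_ h2)
      refine qabs_mono _ (by positivity) ?_
      exact le_mul_of_one_le_left (by positivity) hρ
    have hsS : ((s : ℕ) : ℝ) ≤ S := by exact_mod_cast s.2.le
    have huL : ((u.1 : ℕ) : ℝ) ≤ L := by exact_mod_cast u.1.2.le
    have he1 : Real.exp (ℓ * ww θ u * (s : ℕ)) ≤ Real.exp (H * W * (ρ * S)) := by
      apply Real.exp_le_exp.mpr
      refine mul_le_mul ((le_abs_self _).trans h3) (hsS.trans ?_) (by positivity) (by positivity)
      exact le_mul_of_one_le_left (by positivity) hρ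
    have he2 : |Real.exp ((u.1 : ℕ) * Λ * (s : ℕ)) - 1| ≤ (ρ⁻¹) ^ (2 * X') := by
      have hz : |(u.1 : ℕ) * Λ * (s : ℕ)| ≤ L * S * |Λ| := by
        rw [abs_mul, abs_mul, Nat.abs_cast, Nat.abs_cast]
        calc _ ≤ L * |Λ| * S := by gcongr
          _ = _ := by ring
      have hp1 : (ρ⁻¹) ^ (2 * X') ≤ 1 := pow_le_one₀ (by positivity) hρi
      have hz1 : |(u.1 : ℕ) * Λ * (s : ℕ)| ≤ 1 := by linarith [abs_nonneg ((u.1 : ℕ) * Λ * (s : ℕ))]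
      refine (Real.abs_exp_sub_one_le hz1).trans ?_
      linarith
    have key : hd * ww θ u ^ (t : ℕ) * (Real.exp (ℓ * ww θ u * (s : ℕ)) * Real.exp ((u.1 : ℕ) * Λ * (s : ℕ))) -
        ww θ u ^ (t : ℕ) * app = ww θ u ^ (t : ℕ) * ((hd * Real.exp (ℓ * ww θ u * (s : ℕ)) - app) +
          hd * Real.exp (ℓ * ww θ u * (s : ℕ)) * (Real.exp ((u.1 : ℕ) * Λ * (s : ℕ)) - 1)) := by ring
    rw [key, abs_mul]
    have hfirst : |hd * Real.exp (ℓ * ww θ u * (s : ℕ)) - app| ≤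
        (ρ⁻¹) ^ (2 * X') * (Real.exp (H * W) * (Bq * Real.exp (H * W * (ρ * S)))) := by
      refine h1.trans ?_
      calc _ ≤ Real.exp (H * W) * ((ρ⁻¹) ^ (2 * X') * (Bq * Real.exp (H * W * (ρ * S)))) := by gcongr
        _ = _ := by ring
    have hsecond : |hd * Real.exp (ℓ * ww θ u * (s : ℕ)) * (Real.exp ((u.1 : ℕ) * Λ * (s : ℕ)) - 1)| ≤
        (ρ⁻¹) ^ (2 * X') * (Real.exp (H * W) * (Bq * Real.exp (H * W * (ρ * S)))) := by
      rw [abs_mul, abs_mul, Real.abs_exp]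
      have h1e : 1 ≤ Real.exp (H * W) := Real.one_le_exp (by positivity)
      calc _ ≤ Bq * Real.exp (H * W * (ρ * S)) * (ρ⁻¹) ^ (2 * X') := by gcongr
        _ = (ρ⁻¹) ^ (2 * X') * (1 * (Bq * Real.exp (H * W * (ρ * S)))) := by ring
        _ ≤ _ := by gcongr
    calc _ ≤ W ^ T * ((ρ⁻¹) ^ (2 * X') * (Real.exp (H * W) * (Bq * Real.exp (H * W * (ρ * S)))) +
          (ρ⁻¹) ^ (2 * X') * (Real.exp (H * W) * (Bq * Real.exp (H * W * (ρ * S))))) := by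
          refine mul_le_mul (hwt u t) ((abs_add_le _ _).trans (add_le_add hfirst hsecond)) (abs_nonneg _) (by positivity)
      _ = _ := by rw [hB0, ← pow_mul, mul_comm X' 2]; ring
  have hfin := det_low_rank ((Cm0 * V).submatrix f id)
    ((MM θ x y T S N0 L - Cm0 * V).submatrix f id) (Cm0.submatrix f id) V (by
      ext i j; simp [Matrix.mul_apply]) (by simpa using hcard) (2 * B0) ((ρ⁻¹) ^ X') (by positivity) (by positivity)
    (pow_le_one₀ (by positivity) hρi) (fun i j => by
      have := hAb (f i) j
      simp only [submatrix_apply, id]; linarith) (fun i j => by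
      simpa using hR (f i) j)
  have hsum : (Cm0 * V).submatrix f id + (MM θ x y T S N0 L - Cm0 * V).submatrix f id =
      (MM θ x y T S N0 L).submatrix f id := by
    ext i j; simp
  rw [hsum] at hfin
  simpa using hfin

end LBE


namespace LBE
open Polynomial Finset Matrix

theorem frac_pow (h k m e : ℕ) (hk : 0 < k) (he : e ≤ m) :
    (h : ℝ) ^ e * (k : ℝ) ^ (m - e) = (k : ℝ) ^ m * ((h : ℝ) / k) ^ e := by
  have hk' : (k : ℝ) ≠ 0 := by positivity
  have : (k : ℝ) ^ m = (k : ℝ) ^ e * (k : ℝ) ^ (m - e) := by rw [← pow_add]; congr 1; omega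
  rw [this, div_pow]; field_simp

theorem det_lower {θ : ℝ} (a : ℕ) (ha : 1 ≤ a) (R : ℝ) (hR : 1 ≤ R) (d' : ℕ)
    (hliou : ∀ Q : ℤ[X], aeval ((a : ℝ) * θ) Q ≠ 0 →
      ∀ B : ℝ, 1 ≤ B → (∀ z : ℂ, ‖z‖ ≤ R → ‖aeval z Q‖ ≤ B) → 1 ≤ |aeval ((a : ℝ) * θ) Q| * B ^ d')
    (h1 h2 r1 r2 Mx : ℕ) (hh1 : 0 < h1) (hh2 : 0 < h2) (hr1 : 0 < r1) (hr2 : 0 < r2)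
    (hm1 : h1 ≤ Mx) (hm2 : h2 ≤ Mx) (hm3 : r1 ≤ Mx) (hm4 : r2 ≤ Mx)
    (T S N0 L dS : ℕ) (hL : 1 ≤ L) (hdS : 1 ≤ dS) (hdd : ∀ l, 1 ≤ l → l ≤ S → l ∣ dS)
    (Bq : ℝ) (hBq1 : 1 ≤ Bq) (hBq : ∀ n < N0, qabs (qn S n) S ≤ Bq)
    (f : Fin N0 × (Fin L × Fin L) → Fin T × Fin T × Fin S)
    (hne : ((MM θ ((h1 : ℝ) / h2) ((r1 : ℝ) / r2) T S N0 L).submatrix f id).det ≠ 0)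
    (B1 : ℝ) (hB1 : B1 = (dS : ℝ) ^ T * Bq * (a * L * (1 + R)) ^ T * (Mx : ℝ) ^ (2 * (L * S))) :
    1 ≤ B1 ^ (N0 * (L * L)) *
      |((MM θ ((h1 : ℝ) / h2) ((r1 : ℝ) / r2) T S N0 L).submatrix f id).det| *
      ((N0 * (L * L)).factorial * B1 ^ (N0 * (L * L))) ^ d' := by
  classical
  choose z hz using fun (n k s : ℕ) (hk : k ≤ T) => qn_int dS S hdd n k s T hk
  set P : Matrix (Fin T × Fin T × Fin S) (Fin N0 × (Fin L × Fin L)) ℤ[X] := Matrix.of fun r c =>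
    C (z c.1 r.1 r.2.2 r.1.2.le * (a : ℤ) ^ (T - (r.2.1 : ℕ)) *
      (((h1 : ℤ) ^ ((c.2.1 : ℕ) * (r.2.2 : ℕ)) * (h2 : ℤ) ^ (L * S - (c.2.1 : ℕ) * (r.2.2 : ℕ))) *
      ((r1 : ℤ) ^ ((c.2.2 : ℕ) * (r.2.2 : ℕ)) * (r2 : ℤ) ^ (L * S - (c.2.2 : ℕ) * (r.2.2 : ℕ))))) *
      (C ((a : ℤ) * (c.2.2 : ℕ)) - X * C (((c.2.1 : ℕ) : ℤ))) ^ (r.2.1 : ℕ) with hP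
  set D0 : ℝ := (dS : ℝ) ^ T * (a : ℝ) ^ T * ((h2 : ℝ) ^ (L * S) * (r2 : ℝ) ^ (L * S)) with hD0
  have hle : ∀ (i : Fin L) (s : Fin S), (i : ℕ) * (s : ℕ) ≤ L * S :=
    fun i s => Nat.mul_le_mul i.2.le s.2.le
  have hPe : ∀ r c, aeval ((a : ℝ) * θ) (P r c) = D0 * MM θ ((h1 : ℝ) / h2) ((r1 : ℝ) / r2) T S N0 L r c := by
    rintro ⟨k, t, s⟩ ⟨n, u⟩
    have hzz := hz n k s k.2.le
    have e1 := frac_pow h1 h2 (L * S) ((u.1 : ℕ) * s) hh2 (hle u.1 s)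
    have e2 := frac_pow r1 r2 (L * S) ((u.2 : ℕ) * s) hr2 (hle u.2 s)
    have e3 : (a : ℝ) ^ T = (a : ℝ) ^ (T - (t : ℕ)) * (a : ℝ) ^ (t : ℕ) := by
      rw [← pow_add]; congr 1; have := t.2; omega
    simp only [hP, MM, Matrix.of_apply, AA, map_mul, map_pow, map_sub, aeval_C, aeval_X]
    simp only [algebraMap_int_eq, eq_intCast, Int.cast_natCast]
    rw [e1, e2, ← hzz, hD0, e3, mul_pow (_ ^ _), ← pow_mul, ← pow_mul,
      show (a : ℝ) * ((u.2 : ℕ) : ℝ) - a * θ * ((u.1 : ℕ) : ℝ) = a * ww θ u by rw [ww]; ring, mul_pow]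
    ring
  have hMx1 : (1 : ℝ) ≤ Mx := by exact_mod_cast (by omega : 1 ≤ Mx)
  have ha' : (1 : ℝ) ≤ a := by exact_mod_cast ha
  have hL' : (1 : ℝ) ≤ L := by exact_mod_cast hL
  have hd' : (1 : ℝ) ≤ dS := by exact_mod_cast hdS
  have haLR : (1 : ℝ) ≤ a * L * (1 + R) :=
    one_le_mul_of_one_le_of_one_le (one_le_mul_of_one_le_of_one_le ha' hL') (by linarith)
  have hB1one : 1 ≤ B1 := by
    rw [hB1]
    refine one_le_mul_of_one_le_of_one_le (one_le_mul_of_one_le_of_one_le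
      (one_le_mul_of_one_le_of_one_le (one_le_pow₀ hd') hBq1) (one_le_pow₀ haLR)) (one_le_pow₀ hMx1)
  have hD0le : |D0| ≤ B1 := by
    rw [abs_of_nonneg (by positivity), hB1, hD0]
    have e1 : (h2 : ℝ) ^ (L * S) * (r2 : ℝ) ^ (L * S) ≤ (Mx : ℝ) ^ (2 * (L * S)) := by
      rw [two_mul, pow_add]; gcongr
    have e2 : (a : ℝ) ^ T ≤ (a * L * (1 + R)) ^ T := by
      gcongr
      rw [mul_assoc]
      refine le_mul_of_one_le_right (by positivity) ?_
      exact one_le_mul_of_one_le_of_one_le hL' (by linarith)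
    have e3 : (dS : ℝ) ^ T * (a : ℝ) ^ T ≤ (dS : ℝ) ^ T * Bq * (a * L * (1 + R)) ^ T := by
      refine mul_le_mul (le_mul_of_one_le_right (by positivity) hBq1) e2 (by positivity) (by positivity)
    exact mul_le_mul e3 e1 (by positivity) (by positivity)
  have hPb : ∀ (w : ℂ), ‖w‖ ≤ R → ∀ r c, ‖aeval w (P r c)‖ ≤ B1 := by
    rintro w hw ⟨k, t, s⟩ ⟨n, u⟩
    have hzz := hz n k s k.2.le
    simp only [hP, Matrix.of_apply, map_mul, map_pow, map_sub, aeval_C, aeval_X]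
    simp only [algebraMap_int_eq, eq_intCast, Int.cast_natCast]
    simp only [norm_mul, norm_pow, Complex.norm_natCast, Complex.norm_intCast]
    have b1 : |(z n k s k.2.le : ℝ)| ≤ (dS : ℝ) ^ T * Bq := by
      rw [← hzz, abs_mul, abs_of_nonneg (a := (dS : ℝ) ^ T) (by positivity)]
      gcongr
      exact (hasse_abs_le (qn S n) k s S s.2).trans (hBq n n.2)
    have b2 : ∀ (p q : ℕ) (i : Fin L), p ≤ Mx → q ≤ Mx →
        (p : ℝ) ^ ((i : ℕ) * (s : ℕ)) * (q : ℝ) ^ (L * S - (i : ℕ) * (s : ℕ)) ≤ (Mx : ℝ) ^ (L * S) := by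
      intro p q i hp hq
      have : (Mx : ℝ) ^ (L * S) = (Mx : ℝ) ^ ((i : ℕ) * (s : ℕ)) * (Mx : ℝ) ^ (L * S - (i : ℕ) * (s : ℕ)) := by
        rw [← pow_add]; congr 1; have := hle i s; omega
      rw [this]
      gcongr
    have b3 : ‖(a : ℂ) * ((u.2 : ℕ) : ℂ) - w * ((u.1 : ℕ) : ℂ)‖ ≤ a * L * (1 + R) := by
      refine (norm_sub_le _ _).trans ?_
      rw [norm_mul, norm_mul, Complex.norm_natCast, Complex.norm_natCast, Complex.norm_natCast]
      have hu1 : ((u.1 : ℕ) : ℝ) ≤ L := by exact_mod_cast u.1.2.le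
      have hu2 : ((u.2 : ℕ) : ℝ) ≤ L := by exact_mod_cast u.2.2.le
      calc _ ≤ a * (L : ℝ) + R * L := by gcongr
        _ ≤ a * (L : ℝ) + a * (R * L) := by
          have := le_mul_of_one_le_left (b := R * (L : ℝ)) (by positivity) ha'
          linarith
        _ = _ := by ring
    have b4 : (a : ℝ) ≤ a * L * (1 + R) := by
      rw [mul_assoc]
      refine le_mul_of_one_le_right (by positivity) ?_
      exact one_le_mul_of_one_le_of_one_le hL' (by linarith)
    have b5 : (a : ℝ) ^ (T - (t : ℕ)) * ‖(a : ℂ) * ((u.2 : ℕ) : ℂ) - w * ((u.1 : ℕ) : ℂ)‖ ^ (t : ℕ) ≤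
        (a * L * (1 + R)) ^ T := by
      have : ((a : ℝ) * L * (1 + R)) ^ T = (a * L * (1 + R)) ^ (T - (t : ℕ)) * (a * L * (1 + R)) ^ (t : ℕ) := by
        rw [← pow_add]; congr 1; have := t.2; omega
      rw [this]
      gcongr
    have b6 := mul_le_mul (b2 h1 h2 u.1 hm1 hm2) (b2 r1 r2 u.2 hm3 hm4) (by positivity) (by positivity)
    rw [← pow_add, ← two_mul] at b6
    have b7 := mul_le_mul (mul_le_mul b1 b5 (by positivity) (by positivity)) b6 (by positivity) (by positivity)
    rw [← hB1] at b7
    refine le_trans (le_of_eq ?_) b7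
    ring
  set Q := (P.submatrix f id).det with hQ
  have hcard : Fintype.card (Fin N0 × (Fin L × Fin L)) = N0 * (L * L) := by simp
  have hQe : aeval ((a : ℝ) * θ) Q = D0 ^ (N0 * (L * L)) *
      ((MM θ ((h1 : ℝ) / h2) ((r1 : ℝ) / r2) T S N0 L).submatrix f id).det := by
    rw [hQ, AlgHom.map_det, ← hcard, ← det_smul]
    congr 1
    ext i j
    simp [hPe]
  have hD0pos : D0 ≠ 0 := by
    have : 0 < D0 := by rw [hD0]; positivity
    exact this.ne'
  have hQne : aeval ((a : ℝ) * θ) Q ≠ 0 := by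
    rw [hQe]; exact mul_ne_zero (pow_ne_zero _ hD0pos) hne
  have hfact : (1 : ℝ) ≤ (N0 * (L * L)).factorial := by exact_mod_cast Nat.one_le_iff_ne_zero.mpr (Nat.factorial_ne_zero _)
  have := hliou Q hQne ((N0 * (L * L)).factorial * B1 ^ (N0 * (L * L)))
    (one_le_mul_of_one_le_of_one_le hfact (one_le_pow₀ hB1one)) (by
      intro w hw
      rw [hQ, AlgHom.map_det]
      have := Matrix.det_le (A := (aeval w).mapMatrix (P.submatrix f id)) (abv := NormedField.toAbsoluteValue ℂ)
        (x := B1) (by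
          intro i j
          exact hPb w hw (f i) j)
      rw [hcard, nsmul_eq_mul] at this
      exact this)
  refine this.trans ?_
  gcongr
  rw [hQe, abs_mul, abs_pow]
  gcongr

/-- The combined inequality. -/
theorem core {θ : ℝ} (hθ : Irrational θ) (a : ℕ) (ha : 1 ≤ a) (R : ℝ) (hR : 1 ≤ R) (d' : ℕ)
    (hliou : ∀ Q : ℤ[X], aeval ((a : ℝ) * θ) Q ≠ 0 →
      ∀ B : ℝ, 1 ≤ B → (∀ z : ℂ, ‖z‖ ≤ R → ‖aeval z Q‖ ≤ B) → 1 ≤ |aeval ((a : ℝ) * θ) Q| * B ^ d')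
    (h1 h2 r1 r2 Mx : ℕ) (hh1 : 0 < h1) (hh2 : 0 < h2) (hr1 : 0 < r1) (hr2 : 0 < r2)
    (hm1 : h1 ≤ Mx) (hm2 : h2 ≤ Mx) (hm3 : r1 ≤ Mx) (hm4 : r2 ≤ Mx) (hx1 : h1 ≠ h2)
    (L Kp τ S E X' : ℕ) (hL : 1 ≤ L) (hS : 1 ≤ S) (hE : 1 ≤ E)
    (hK : L * L ≤ Kp * (τ - L))
    (hT1 : E * S ≤ (S - Kp) * (2 * τ)) (hT2 : L * L * (E * S) ≤ (S - Kp) * (2 * τ * τ))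
    (hcard : 2 * (2 * (2 * τ) * (2 * X')) ≤ E * S * (L * L))
    (ρ W Bq B0 B1 : ℝ) (hρ : 1 ≤ ρ) (hW : 1 ≤ W) (hWL : (1 + |θ|) * L ≤ W)
    (hBq : Bq = (Real.exp 1 * (ρ + 1)) ^ (E * S) * (ρ * S) ^ S)
    (hB0 : B0 = W ^ (2 * τ) * (Real.exp (Real.log Mx * W) * (Bq * Real.exp (Real.log Mx * W * (ρ * S)))))
    (hB1 : B1 = Real.exp (6 * S) ^ (2 * τ) * Bq * (a * L * (1 + R)) ^ (2 * τ) * (Mx : ℝ) ^ (2 * (L * S)))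
    (hΛ : 2 * (L * S * |Real.log ((h1 : ℝ) / h2) + θ * Real.log ((r1 : ℝ) / r2)|) ≤ (ρ⁻¹) ^ (2 * X')) :
    ρ ^ X' ≤ 4 * B0 * ((E * S * (L * L) : ℕ) * B1) ^ (d' + 1) := by
  have hMx1 : (1 : ℝ) ≤ Mx := by exact_mod_cast (by omega : 1 ≤ Mx)
  have hS' : (1 : ℝ) ≤ S := by exact_mod_cast hS
  have hx : (0 : ℝ) < (h1 : ℝ) / h2 := by positivity
  have hy : (0 : ℝ) < (r1 : ℝ) / r2 := by positivity
  have hx1' : (h1 : ℝ) / h2 ≠ 1 := by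
    intro h
    rw [div_eq_one_iff_eq (by positivity)] at h
    exact hx1 (by exact_mod_cast h)
  have hρ0 : 0 < ρ := by linarith
  obtain ⟨f, hf⟩ := MM_minor hθ hx hx1' hy L Kp τ S (E * S) hK (Nat.mul_pos hE hS) hT1 hT2
  have hqb : ∀ n < E * S, qabs (qn S n) (ρ * S) ≤ Bq := fun n hn => by
    rw [hBq]; exact qabs_qn S E n hS hn hρ
  have hBq1 : 1 ≤ Bq := by
    rw [hBq]
    refine one_le_mul_of_one_le_of_one_le (one_le_pow₀ (one_le_mul_of_one_le_of_one_le
      (Real.one_le_exp zero_le_one) (by linarith))) (one_le_pow₀ (one_le_mul_of_one_le_of_one_le hρ hS'))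
  have hqS : ∀ n < E * S, qabs (qn S n) S ≤ Bq := fun n hn =>
    (qabs_mono _ (by positivity) (le_mul_of_one_le_left (by positivity) hρ)).trans (hqb n hn)
  have hww : ∀ u : Fin L × Fin L, |ww θ u| ≤ W := by
    intro u
    refine le_trans ?_ hWL
    rw [ww]
    refine (abs_sub _ _).trans ?_
    rw [abs_mul, Nat.abs_cast, Nat.abs_cast]
    have hu1 : ((u.1 : ℕ) : ℝ) ≤ L := by exact_mod_cast u.1.2.le
    have hu2 : ((u.2 : ℕ) : ℝ) ≤ L := by exact_mod_cast u.2.2.le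
    calc _ ≤ (L : ℝ) + |θ| * L := by gcongr
      _ = _ := by ring
  have hlog : |Real.log ((r1 : ℝ) / r2)| ≤ Real.log Mx := by
    rw [Real.log_div (by positivity) (by positivity)]
    have g1 : 0 ≤ Real.log r1 := Real.log_natCast_nonneg _
    have g2 : 0 ≤ Real.log r2 := Real.log_natCast_nonneg _
    have g3 : Real.log r1 ≤ Real.log Mx := Real.log_le_log (by positivity) (by exact_mod_cast hm3)
    have g4 : Real.log r2 ≤ Real.log Mx := Real.log_le_log (by positivity) (by exact_mod_cast hm4)
    rw [abs_le]; constructor <;> linarith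
  have hup := det_upper hx hy (2 * τ) S (E * S) L X' hcard ρ W (Real.log Mx) Bq hρ hW hww hlog hqb
    (by linarith) hΛ f
  rw [← hB0] at hup
  obtain ⟨dS, hd1, hd2, hd3⟩ := lcm_exists S
  set Bd := (dS : ℝ) ^ (2 * τ) * Bq * (a * L * (1 + R)) ^ (2 * τ) * (Mx : ℝ) ^ (2 * (L * S)) with hBd
  have hlo := det_lower a ha R hR d' hliou h1 h2 r1 r2 Mx hh1 hh2 hr1 hr2 hm1 hm2 hm3 hm4 (2 * τ) S (E * S) L dS
    hL hd1 hd2 Bq hBq1 hqS f hf Bd hBd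
  set Δ := |((MM θ ((h1 : ℝ) / h2) ((r1 : ℝ) / r2) (2 * τ) S (E * S) L).submatrix f id).det| with hΔ
  set N := E * S * (L * L) with hN
  have hN1 : 1 ≤ N := Nat.mul_pos (Nat.mul_pos hE hS) (Nat.mul_pos hL hL)
  have hB1d : Bd ≤ B1 := by
    rw [hBd, hB1]
    have : (0 : ℝ) ≤ 1 + R := by linarith
    gcongr
  have hBd0 : 0 ≤ Bd := by
    rw [hBd]
    have : (0 : ℝ) ≤ 1 + R := by linarith
    positivity
  have hB10 : 0 ≤ B1 := hBd0.trans hB1d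
  have hB00 : 0 ≤ B0 := by
    rw [hB0]
    have : (0 : ℝ) ≤ W := by linarith
    positivity
  have hNf : (N.factorial : ℝ) ≤ (N : ℝ) ^ N := by exact_mod_cast Nat.factorial_le_pow N
  have hΔ0 : 0 ≤ Δ := abs_nonneg _
  have hall : 1 ≤ (4 * B0 * ((N : ℝ) * B1) ^ (d' + 1) * (ρ⁻¹) ^ X') ^ N := by
    calc (1 : ℝ) ≤ Bd ^ N * Δ * (N.factorial * Bd ^ N) ^ d' := hlo
      _ ≤ B1 ^ N * (2 ^ N * ((N : ℝ) ^ N * ((2 * B0) ^ N * ((ρ⁻¹) ^ X') ^ N))) * ((N : ℝ) ^ N * B1 ^ N) ^ d' := by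
        gcongr
        refine hup.trans ?_
        gcongr
      _ = _ := by
        have e1 : ((N : ℝ) ^ N * B1 ^ N) ^ d' = (((N : ℝ) * B1) ^ d') ^ N := by
          rw [← mul_pow, ← pow_mul, ← pow_mul, mul_comm N d']
        rw [e1]
        simp only [← mul_pow]
        congr 1; ring
  have hbase : 1 ≤ 4 * B0 * ((N : ℝ) * B1) ^ (d' + 1) * (ρ⁻¹) ^ X' := by
    by_contra hlt
    push Not at hlt
    have := pow_lt_one₀ (by positivity) hlt (by omega : N ≠ 0)
    linarith
  rw [inv_pow, ← div_eq_mul_inv, le_div_iff₀ (by positivity), one_mul] at hbase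
  exact hbase

end LBE


namespace LBE
open Polynomial Finset Matrix

set_option maxHeartbeats 2000000 in
theorem param {θ : ℝ} (hθ : Irrational θ) (a : ℕ) (ha : 1 ≤ a) (R : ℝ) (hR : 1 ≤ R) (d' : ℕ)
    (hliou : ∀ Q : ℤ[X], aeval ((a : ℝ) * θ) Q ≠ 0 →
      ∀ B : ℝ, 1 ≤ B → (∀ z : ℂ, ‖z‖ ≤ R → ‖aeval z Q‖ ≤ B) → 1 ≤ |aeval ((a : ℝ) * θ) Q| * B ^ d')
    (h1 h2 r1 r2 Mx : ℕ) (hh1 : 0 < h1) (hh2 : 0 < h2) (hr1 : 0 < r1) (hr2 : 0 < r2)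
    (hm1 : h1 ≤ Mx) (hm2 : h2 ≤ Mx) (hm3 : r1 ≤ Mx) (hm4 : r2 ≤ Mx) (hx1 : h1 ≠ h2)
    (D g S : ℕ) (hD : D = 4 * (d' + 2)) (hg : 2 ≤ g) (hS : 64 * D ≤ S)
    (lam w : ℝ) (hlam : lam = 192 * D + 7) (hw : w = (1 + |θ|) * (16 * D))
    (p1 : Real.log S ≤ (g : ℝ) ^ 2) (p2 : lam ≤ (g : ℝ) ^ 2)
    (p3 : 32 * D * Real.log (w * g) ≤ S) (p4 : 2 * Real.log Mx * w * Real.exp lam ≤ g)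
    (p5 : 32 * D * Real.log (a * (16 * D * g) * (1 + R)) ≤ S)
    (p6 : 32 * D * Real.log Mx ≤ g)
    (p7 : Real.log (g ^ 2 * S * (16 * D * g * (16 * D * g)) : ℕ) ≤ (g : ℝ) ^ 2 * S) :
    Real.exp (-(2 * D * lam * (g ^ 2 * S))) <
      2 * (16 * D * g * S * |Real.log ((h1 : ℝ) / h2) + θ * Real.log ((r1 : ℝ) / r2)|) := by
  by_contra hcon
  push Not at hcon
  have hD1 : 8 ≤ D := by omega
  have hD1r : (8 : ℝ) ≤ D := by exact_mod_cast hD1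
  have hgr : (2 : ℝ) ≤ g := by exact_mod_cast hg
  have hS1 : 1 ≤ S := by omega
  have hSr : (64 * D : ℝ) ≤ S := by exact_mod_cast hS
  have hSr1 : (1 : ℝ) ≤ S := by exact_mod_cast hS1
  have hMx1 : (1 : ℝ) ≤ Mx := by exact_mod_cast (by omega : 1 ≤ Mx)
  have hH : 0 ≤ Real.log Mx := Real.log_nonneg hMx1
  have hw1 : 1 ≤ w := by
    rw [hw]
    have := abs_nonneg θ
    nlinarith
  have hlam0 : 0 ≤ lam := by rw [hlam]; positivity
  set ρ := Real.exp lam with hρdef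
  have hρ : 1 ≤ ρ := Real.one_le_exp hlam0
  set G : ℝ := (g : ℝ) ^ 2 * S with hG
  have ha' : (1 : ℝ) ≤ a := by exact_mod_cast ha
  set Bq : ℝ := (Real.exp 1 * (ρ + 1)) ^ (g ^ 2 * S) * (ρ * S) ^ S with hBq
  set W : ℝ := w * g with hWdef
  have hW1 : 1 ≤ W := one_le_mul_of_one_le_of_one_le hw1 (by linarith)
  set B0 : ℝ := W ^ (2 * (16 * D * g ^ 2)) * (Real.exp (Real.log Mx * W) *
    (Bq * Real.exp (Real.log Mx * W * (ρ * S)))) with hB0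
  set B1 : ℝ := Real.exp (6 * S) ^ (2 * (16 * D * g ^ 2)) * Bq *
    (a * (16 * D * g : ℕ) * (1 + R)) ^ (2 * (16 * D * g ^ 2)) * (Mx : ℝ) ^ (2 * (16 * D * g * S)) with hB1
  have hfin := core hθ a ha R hR d' hliou h1 h2 r1 r2 Mx hh1 hh2 hr1 hr2 hm1 hm2 hm3 hm4 hx1
    (16 * D * g) (32 * D) (16 * D * g ^ 2) S (g ^ 2) (D * g ^ 2 * S)
    (Nat.mul_pos (by omega) (by omega)) hS1 (Nat.pos_of_ne_zero (by positivity))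
    (by
      have : 16 * D * g ^ 2 - 16 * D * g = 16 * D * (g * (g - 1)) := by
        rw [Nat.mul_sub, ← pow_two, mul_one, Nat.mul_sub]
      rw [this]
      have h : g ≤ 2 * (g - 1) := by omega
      calc _ = 256 * D * D * g * g := by ring
        _ ≤ 256 * D * D * g * (2 * (g - 1)) := Nat.mul_le_mul_left _ h
        _ = _ := by ring)
    (by
      have h : S ≤ (S - 32 * D) * (2 * (16 * D)) := by
        have : S ≤ (S - 32 * D) * 2 := by omega
        calc S ≤ (S - 32 * D) * 2 * 1 := by omega
          _ ≤ (S - 32 * D) * 2 * (16 * D) := Nat.mul_le_mul_left _ (by omega)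
          _ = _ := by ring
      calc _ = g ^ 2 * S := rfl
        _ ≤ g ^ 2 * ((S - 32 * D) * (2 * (16 * D))) := Nat.mul_le_mul_left _ h
        _ = _ := by ring)
    (by
      have h : S ≤ (S - 32 * D) * 2 := by omega
      calc _ = 256 * D * D * g ^ 4 * S := by ring
        _ ≤ 256 * D * D * g ^ 4 * ((S - 32 * D) * 2) := Nat.mul_le_mul_left _ h
        _ = _ := by ring)
    (by
      apply le_of_eq; ring)
    ρ W Bq B0 B1 hρ hW1 (by
      apply le_of_eq; rw [hWdef, hw]; push_cast; ring) hBq hB0 hB1 (by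
      refine le_trans (le_of_eq ?_) (hcon.trans (le_of_eq ?_))
      · push_cast; ring
      · rw [hρdef, ← Real.exp_neg, ← Real.exp_nat_mul]
        congr 1; push_cast; ring)
  have hBqpos : 0 < Bq := by rw [hBq]; positivity
  have hR0 : 0 < 1 + R := by linarith
  have hB0pos : 0 < B0 := by rw [hB0]; positivity
  have hgpos : 0 < g := by omega
  have hDpos : 0 < D := by omega
  have hMpos : (0 : ℝ) < Mx := by linarith
  have hapos : (0 : ℝ) < a := by linarith
  have hLp : (0 : ℝ) < (16 * D * g : ℕ) := by positivity
  have hB1pos : 0 < B1 := by rw [hB1]; positivity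
  have hNpos : (0 : ℝ) < (g ^ 2 * S * (16 * D * g * (16 * D * g)) : ℕ) := by positivity
  have hSpos : (0 : ℝ) < S := by linarith
  have hlog := Real.log_le_log (by positivity) hfin
  rw [Real.log_pow, Real.log_mul (by positivity) (by positivity), Real.log_mul (by norm_num) hB0pos.ne',
    Real.log_pow, Real.log_mul hNpos.ne' hB1pos.ne'] at hlog
  have eBq : Real.log Bq = (g ^ 2 * S) * (1 + Real.log (ρ + 1)) + S * (lam + Real.log S) := by
    rw [hBq, Real.log_mul (by positivity) (by positivity), Real.log_pow, Real.log_pow,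
      Real.log_mul (by positivity) (by positivity), Real.log_mul (by positivity) (by positivity), Real.log_exp,
      hρdef, Real.log_exp]
    push_cast; ring
  have eB0 : Real.log B0 = 32 * D * g ^ 2 * Real.log W + (Real.log Mx * W +
      (Real.log Bq + Real.log Mx * W * (ρ * S))) := by
    rw [hB0, Real.log_mul (by positivity) (by positivity), Real.log_mul (by positivity) (by positivity),
      Real.log_mul (by positivity) (by positivity), Real.log_pow, Real.log_exp, Real.log_exp]
    push_cast; ring
  have eB1 : Real.log B1 = 192 * D * (g ^ 2 * S) + Real.log Bq +
      32 * D * g ^ 2 * Real.log (a * (16 * D * g) * (1 + R)) + 32 * D * g * S * Real.log Mx := by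
    rw [hB1, Real.log_mul (by positivity) (by positivity), Real.log_mul (by positivity) (by positivity),
      Real.log_mul (by positivity) (by positivity), Real.log_pow, Real.log_pow, Real.log_pow, Real.log_exp]
    push_cast; ring
  have hGp : 1 ≤ G := by
    rw [hG]
    exact one_le_mul_of_one_le_of_one_le (one_le_pow₀ (by linarith)) hSr1
  have q1 : Real.log (ρ + 1) ≤ lam + 1 := by
    rw [Real.log_le_iff_le_exp (by positivity), Real.exp_add, ← hρdef]
    have h1 := Real.add_one_le_exp (1 : ℝ)
    have h2 : ρ * 2 ≤ ρ * Real.exp 1 := by gcongr; linarith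
    linarith
  have q2 : Real.log Bq ≤ G * (lam + 4) := by
    rw [eBq]
    have t1 : (S : ℝ) * (lam + Real.log S) ≤ S * ((g : ℝ) ^ 2 + (g : ℝ) ^ 2) := by gcongr
    have t2 : G * (1 + Real.log (ρ + 1)) ≤ G * (1 + (lam + 1)) := by gcongr
    rw [hG] at t2 ⊢
    linarith
  have q3 : Real.log B0 ≤ G * (lam + 6) := by
    rw [eB0]
    have t1 : (g : ℝ) ^ 2 * (32 * D * Real.log (w * g)) ≤ (g : ℝ) ^ 2 * S := by gcongr
    have t2 : g * S * (2 * Real.log Mx * w * ρ) ≤ g * S * g := by gcongr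
    have t3 : Real.log Mx * W ≤ Real.log Mx * W * (ρ * S) :=
      le_mul_of_one_le_right (by positivity) (one_le_mul_of_one_le_of_one_le hρ hSr1)
    have t4 : Real.log Mx * W * (ρ * S) * 2 = g * S * (2 * Real.log Mx * w * ρ) := by rw [hWdef]; ring
    rw [← hWdef] at t1
    rw [hG] at q2 ⊢
    linarith
  have q4 : Real.log B1 ≤ G * (lam + 192 * D + 6) := by
    rw [eB1]
    have t1 : (g : ℝ) ^ 2 * (32 * D * Real.log (a * (16 * D * g) * (1 + R))) ≤ (g : ℝ) ^ 2 * S := by gcongr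
    have t2 : g * S * (32 * D * Real.log Mx) ≤ g * S * g := by gcongr
    rw [hG] at q2 ⊢
    linarith
  have q5 : Real.log 4 ≤ 2 * G := by
    have : Real.log 4 ≤ 4 - 1 := Real.log_le_sub_one_of_pos (by norm_num)
    have h4 : 2 ≤ G := by
      rw [hG]
      have hg4 : (1 : ℝ) ≤ (g : ℝ) ^ 2 := one_le_pow₀ (by linarith)
      have := le_mul_of_one_le_left hSpos.le hg4
      linarith
    linarith
  have q6 : Real.log ρ = lam := by rw [hρdef, Real.log_exp]
  rw [q6] at hlog
  have q7 : ((d' + 1 : ℕ) : ℝ) * (Real.log (g ^ 2 * S * (16 * D * g * (16 * D * g)) : ℕ) + Real.log B1) ≤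
      ((d' + 1 : ℕ) : ℝ) * (G + G * (lam + 192 * D + 6)) := by gcongr
  have hDr : (D : ℝ) = 4 * (d' + 2) := by rw [hD]; push_cast; ring
  have hd0 : (0 : ℝ) ≤ d' := Nat.cast_nonneg _
  have q8 : D * lam * G ≤ G * (2 + (lam + 6) + (d' + 1) * (lam + 192 * D + 7)) := by
    calc D * lam * G = ((D * g ^ 2 * S : ℕ) : ℝ) * lam := by rw [hG]; push_cast; ring
      _ ≤ _ := hlog
      _ ≤ 2 * G + G * (lam + 6) + ((d' + 1 : ℕ) : ℝ) * (G + G * (lam + 192 * D + 6)) := by linarith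
      _ = _ := by push_cast; ring
  have q9 : D * lam ≤ 2 + (lam + 6) + (d' + 1) * (lam + 192 * D + 7) := by
    have : G * (D * lam) ≤ G * (2 + (lam + 6) + (d' + 1) * (lam + 192 * D + 7)) := by linarith
    exact le_of_mul_le_mul_left this (by linarith)
  have q10 : lam + 192 * D + 7 = 2 * lam := by rw [hlam]; ring
  rw [q10, hDr] at q9
  have q11 : 8 < lam := by rw [hlam]; linarith
  nlinarith

end LBE


namespace LBE
open Polynomial Finset Matrix

theorem one_le_log_three : (1 : ℝ) < Real.log 3 := by
  rw [Real.lt_log_iff_exp_lt (by norm_num)]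
  have := Real.exp_one_lt_d9
  linarith

set_option maxHeartbeats 1000000 in
theorem lam_lower {θ : ℝ} (hθ : Irrational θ) (a : ℕ) (ha : 1 ≤ a) (R : ℝ) (hR : 1 ≤ R) (d' : ℕ)
    (hliou : ∀ Q : ℤ[X], aeval ((a : ℝ) * θ) Q ≠ 0 →
      ∀ B : ℝ, 1 ≤ B → (∀ z : ℂ, ‖z‖ ≤ R → ‖aeval z Q‖ ≤ B) → 1 ≤ |aeval ((a : ℝ) * θ) Q| * B ^ d') :
    ∃ C : ℝ, 0 < C ∧ ∀ h1 h2 r1 r2 Mx : ℕ, 0 < h1 → 0 < h2 → 0 < r1 → 0 < r2 →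
      h1 ≤ Mx → h2 ≤ Mx → r1 ≤ Mx → r2 ≤ Mx → 3 ≤ Mx → h1 ≠ h2 →
      Real.exp (-(C * (Real.log Mx ^ 2 * Real.log (Real.log Mx)))) <
        |Real.log ((h1 : ℝ) / h2) + θ * Real.log ((r1 : ℝ) / r2)| := by
  obtain ⟨D, hD⟩ : ∃ D : ℕ, D = 4 * (d' + 2) := ⟨_, rfl⟩
  have hD1 : 8 ≤ D := by omega
  have hD1r : (8 : ℝ) ≤ D := by exact_mod_cast hD1
  have ha' : (1 : ℝ) ≤ a := by exact_mod_cast ha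
  obtain ⟨lam, hlam⟩ : ∃ lam : ℝ, lam = 192 * D + 7 := ⟨_, rfl⟩
  obtain ⟨w, hw⟩ : ∃ w : ℝ, w = (1 + |θ|) * (16 * D) := ⟨_, rfl⟩
  have hw1 : 1 ≤ w := by
    rw [hw]
    have := abs_nonneg θ
    nlinarith
  have hlam0 : 0 ≤ lam := by rw [hlam]; positivity
  obtain ⟨A, hA⟩ : ∃ A : ℝ, A = max w (a * (16 * D) * (1 + R)) := ⟨_, rfl⟩
  have hA1 : 1 ≤ A := by rw [hA]; exact hw1.trans (le_max_left _ _)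
  have hlA : 0 ≤ Real.log A := Real.log_nonneg hA1
  obtain ⟨c5, hc5⟩ : ∃ c5 : ℝ, c5 = 64 * D * (1 + Real.log A) := ⟨_, rfl⟩
  have hc5D : 64 * D ≤ c5 := by rw [hc5]; nlinarith
  obtain ⟨c4, hc4⟩ : ∃ c4 : ℝ, c4 = 2 * w * Real.exp lam + 32 * D + lam + c5 + 2 := ⟨_, rfl⟩
  have hc40 : c5 + 2 ≤ c4 := by
    rw [hc4]
    have : 0 ≤ 2 * w * Real.exp lam := by positivity
    linarith
  have hc4l : lam ≤ c4 := by
    rw [hc4]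
    have : 0 ≤ 2 * w * Real.exp lam := by positivity
    linarith
  have hc4w : 2 * w * Real.exp lam ≤ c4 := by rw [hc4]; linarith
  have hc4D : 32 * (D : ℝ) ≤ c4 := by linarith
  have hε : 0 < Real.log (Real.log 3) := Real.log_pos one_le_log_three
  set ε := Real.log (Real.log 3) with hεd
  have hlc : 0 ≤ Real.log (c4 + 1) := Real.log_nonneg (by linarith)
  obtain ⟨c6, hc6⟩ : ∃ c6 : ℝ, c6 = (1 + Real.log (c4 + 1)) / ε + 1 := ⟨_, rfl⟩
  have hc60 : 0 < c6 := by rw [hc6]; positivity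
  refine ⟨(2 * D * lam + 32 * D) * ((c4 + 1) ^ 2 * ((c5 + 1) * c6)), ?_, ?_⟩
  · have : 0 < c4 + 1 := by linarith
    have : 0 < c5 + 1 := by linarith
    positivity
  intro h1 h2 r1 r2 Mx hh1 hh2 hr1 hr2 hm1 hm2 hm3 hm4 hMx hx1
  have hMr : (3 : ℝ) ≤ Mx := by exact_mod_cast hMx
  have hH3 : Real.log 3 ≤ Real.log Mx := Real.log_le_log (by norm_num) hMr
  set H := Real.log Mx with hHdef
  have hH1 : 1 < H := one_le_log_three.trans_le hH3
  have hlH : ε ≤ Real.log H := Real.log_le_log (by linarith [one_le_log_three]) hH3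
  set g := ⌈c4 * H⌉₊ with hgdef
  have hg1 : c4 * H ≤ g := Nat.le_ceil _
  have hc4pos : 0 < c4 := by linarith
  have hgc4 : c4 ≤ g := by nlinarith
  have hg2 : (g : ℝ) ≤ (c4 + 1) * H := by
    have := (Nat.ceil_lt_add_one (by positivity : 0 ≤ c4 * H)).le
    rw [← hgdef] at this
    linarith
  have hgr : (2 : ℝ) ≤ g := by linarith
  have hg2n : 2 ≤ g := by exact_mod_cast hgr
  have hlg : 0 ≤ Real.log g := Real.log_nonneg (by linarith)
  have hlgg : Real.log g ≤ g - 1 := Real.log_le_sub_one_of_pos (by linarith)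
  set S := ⌈c5 * (1 + Real.log g)⌉₊ with hSdef
  have hS1 : c5 * (1 + Real.log g) ≤ S := Nat.le_ceil _
  have hc5pos : 0 < c5 := by linarith
  have hS2 : (S : ℝ) ≤ (c5 + 1) * (1 + Real.log g) := by
    have := (Nat.ceil_lt_add_one (by positivity : 0 ≤ c5 * (1 + Real.log g))).le
    rw [← hSdef] at this
    linarith
  have hS5 : c5 ≤ S := by nlinarith
  have hS64r : (64 * D : ℝ) ≤ S := by linarith
  have hS64 : 64 * D ≤ S := by exact_mod_cast hS64r
  have hSpos : (0 : ℝ) < S := by linarith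
  have hgpos : (0 : ℝ) < g := by linarith
  have hDpos : (0 : ℝ) < D := by linarith
  have hlogS : Real.log S ≤ c5 + g - 1 := by
    calc Real.log S ≤ Real.log ((c5 + 1) * (1 + Real.log g)) := Real.log_le_log hSpos hS2
      _ = Real.log (c5 + 1) + Real.log (1 + Real.log g) :=
        Real.log_mul (by positivity) (by positivity)
      _ ≤ c5 + Real.log g := by
        have e1 := Real.log_le_sub_one_of_pos (by positivity : 0 < c5 + 1)
        have e2 := Real.log_le_sub_one_of_pos (by positivity : 0 < 1 + Real.log g)
        linarith
      _ ≤ _ := by linarith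
  have hlogx : ∀ x : ℝ, 0 < x → x ≤ A → 32 * D * Real.log (x * g) ≤ S := by
    intro x hx hxA
    have e1 : Real.log (x * g) ≤ (1 + Real.log A) * (1 + Real.log g) := by
      rw [Real.log_mul hx.ne' (by positivity)]
      have := Real.log_le_log hx hxA
      have := mul_nonneg hlA hlg
      linarith
    have e2 : 0 ≤ (1 + Real.log A) * (1 + Real.log g) := by positivity
    calc 32 * D * Real.log (x * g) ≤ 32 * D * ((1 + Real.log A) * (1 + Real.log g)) := by gcongr
      _ ≤ 64 * D * ((1 + Real.log A) * (1 + Real.log g)) := by gcongr; norm_num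
      _ = c5 * (1 + Real.log g) := by rw [hc5]; ring
      _ ≤ S := hS1
  have hR0 : 0 < 1 + R := by linarith
  have key := param hθ a ha R hR d' hliou h1 h2 r1 r2 Mx hh1 hh2 hr1 hr2 hm1 hm2 hm3 hm4 hx1
    D g S hD hg2n hS64 lam w hlam hw
    (by
      have : (2 : ℝ) * g ≤ g ^ 2 := by nlinarith
      linarith)
    (by nlinarith)
    (hlogx w (by linarith) (by rw [hA]; exact le_max_left _ _))
    (by
      calc 2 * Real.log Mx * w * Real.exp lam = 2 * w * Real.exp lam * H := by rw [hHdef]; ring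
        _ ≤ c4 * H := by gcongr
        _ ≤ g := hg1)
    (by
      have := hlogx (a * (16 * D) * (1 + R)) (by positivity) (by rw [hA]; exact le_max_right _ _)
      refine le_trans (le_of_eq ?_) this
      congr 2; ring)
    (by
      calc 32 * D * Real.log Mx ≤ c4 * H := by rw [hHdef]; gcongr
        _ ≤ g := hg1)
    (by
      have e1 : ((g ^ 2 * S * (16 * D * g * (16 * D * g)) : ℕ) : ℝ) = (16 * D) ^ 2 * (g : ℝ) ^ 4 * S := by
        push_cast; ring
      rw [e1, Real.log_mul (by positivity) (by positivity), Real.log_mul (by positivity) (by positivity),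
        Real.log_pow, Real.log_pow]
      have e2 := Real.log_le_sub_one_of_pos (by positivity : (0 : ℝ) < 16 * D)
      have e3 : (g : ℝ) ^ 2 * 8 ≤ (g : ℝ) ^ 2 * S := by gcongr; linarith
      push_cast
      have e4 : (2 : ℝ) * g ≤ g ^ 2 := by nlinarith
      linarith)
  set Λ := |Real.log ((h1 : ℝ) / h2) + θ * Real.log ((r1 : ℝ) / r2)| with hΛ
  have hexp : 2 * (16 * D * g * S) ≤ Real.exp (32 * D * (g ^ 2 * S)) := by
    have e1 := Real.add_one_le_exp (32 * D * (g ^ 2 * S) : ℝ)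
    have e2 : (g : ℝ) ≤ g ^ 2 := by nlinarith
    have e3 : (32 : ℝ) * D * S * g ≤ 32 * D * S * g ^ 2 := by gcongr
    linarith
  have hΛ0 : 0 ≤ Λ := abs_nonneg _
  have hlow : Real.exp (-((2 * D * lam + 32 * D) * (g ^ 2 * S))) < Λ := by
    have e1 : Real.exp (-(2 * D * lam * (g ^ 2 * S))) < Real.exp (32 * D * (g ^ 2 * S)) * Λ := by
      refine key.trans_le ?_
      calc _ = 2 * (16 * D * g * S) * Λ := by ring
        _ ≤ _ := by gcongr
    have e2 : Real.exp (-(2 * D * lam * (g ^ 2 * S))) =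
        Real.exp (32 * D * (g ^ 2 * S)) * Real.exp (-((2 * D * lam + 32 * D) * (g ^ 2 * S))) := by
      rw [← Real.exp_add]; congr 1; ring
    rw [e2] at e1
    exact lt_of_mul_lt_mul_left e1 (Real.exp_pos _).le
  refine lt_of_le_of_lt ?_ hlow
  rw [Real.exp_le_exp, neg_le_neg_iff]
  have hSfin : (S : ℝ) ≤ (c5 + 1) * (c6 * Real.log H) := by
    refine hS2.trans ?_
    gcongr
    have e1 : Real.log g ≤ Real.log (c4 + 1) + Real.log H := by
      rw [← Real.log_mul (by positivity) (by positivity)]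
      exact Real.log_le_log hgpos hg2
    have e2 : 1 + Real.log (c4 + 1) ≤ (1 + Real.log (c4 + 1)) / ε * Real.log H := by
      rw [div_mul_eq_mul_div, le_div_iff₀ hε]
      gcongr
    rw [hc6]
    linarith
  calc (2 * D * lam + 32 * D) * ((g : ℝ) ^ 2 * S)
      ≤ (2 * D * lam + 32 * D) * (((c4 + 1) * H) ^ 2 * ((c5 + 1) * (c6 * Real.log H))) := by gcongr
    _ = _ := by ring

end LBE


namespace LBE
open Polynomial Finset Matrix

theorem log_ratio_lower (r1 r2 Mx : ℕ) (hr1 : 0 < r1) (hr2 : 0 < r2) (hm1 : r1 ≤ Mx) (hm2 : r2 ≤ Mx)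
    (hne : r1 ≠ r2) : 1 / (Mx : ℝ) ≤ |Real.log ((r1 : ℝ) / r2)| := by
  wlog h : r2 < r1 generalizing r1 r2
  · have := this r2 r1 hr2 hr1 hm2 hm1 hne.symm (by omega)
    rwa [← inv_div (r2 : ℝ) (r1 : ℝ), Real.log_inv, abs_neg]
  have h1 : (0 : ℝ) < r1 := by exact_mod_cast hr1
  have h2 : (0 : ℝ) < r2 := by exact_mod_cast hr2
  have h3 : (r2 : ℝ) + 1 ≤ r1 := by exact_mod_cast h
  have h4 : (r1 : ℝ) ≤ Mx := by exact_mod_cast hm1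
  refine le_trans ?_ (le_abs_self _)
  have := Real.one_sub_inv_le_log_of_pos (by positivity : (0 : ℝ) < (r1 : ℝ) / r2)
  refine le_trans ?_ this
  rw [inv_div, one_sub_div h1.ne']
  calc 1 / (Mx : ℝ) ≤ 1 / r1 := by gcongr
    _ ≤ _ := by gcongr; linarith

theorem exp_sub_exp_abs {u v : ℝ} (hu : 0 ≤ u) (hv : 0 ≤ v) :
    |u - v| ≤ |Real.exp u - Real.exp v| := by
  wlog h : v ≤ u generalizing u v
  · rw [abs_sub_comm u, abs_sub_comm (Real.exp u)]
    exact this hv hu (by linarith)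
  rw [abs_of_nonneg (by linarith), abs_of_nonneg (by linarith [Real.exp_le_exp.mpr h])]
  have e1 := Real.add_one_le_exp (u - v)
  have e2 : Real.exp u = Real.exp v * Real.exp (u - v) := by rw [← Real.exp_add]; congr 1; ring
  have e3 := Real.one_le_exp hv
  have e4 : (u - v) * 1 ≤ (Real.exp (u - v) - 1) * Real.exp v := by
    apply mul_le_mul <;> linarith
  rw [e2]
  linarith

theorem final (α β : ℝ) (hα : 0 < α) (hβ : 0 < β)
    (halgα : IsAlgebraic ℚ α) (halgβ : IsAlgebraic ℚ β)
    (hirr : Irrational (β / α)) :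
    ∃ C : ℝ, 0 < C ∧ ∀ h1 h2 r1 r2 Mx : ℕ, 0 < h1 → 0 < h2 → 0 < r1 → 0 < r2 →
      h1 ≤ Mx → h2 ≤ Mx → r1 ≤ Mx → r2 ≤ Mx → 3 ≤ Mx →
      (h1 : ℝ) ^ α * (r1 : ℝ) ^ β ≠ (h2 : ℝ) ^ α * (r2 : ℝ) ^ β →
      Real.exp (-C * Real.log Mx ^ 2 * Real.log (Real.log Mx)) <
        |(h1 : ℝ) ^ α * (r1 : ℝ) ^ β - (h2 : ℝ) ^ α * (r2 : ℝ) ^ β| := by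
  set θ := β / α with hθd
  have hθ0 : 0 < θ := div_pos hβ hα
  have halg : IsAlgebraic ℤ θ := by
    have : IsAlgebraic ℚ θ := by
      rw [hθd, div_eq_mul_inv]
      exact halgβ.mul halgα.inv
    exact (IsFractionRing.isAlgebraic_iff ℤ ℚ ℝ).mpr this
  obtain ⟨a, ha, haint⟩ : ∃ a : ℕ, 1 ≤ a ∧ IsIntegral ℤ ((a : ℝ) * θ) := by
    obtain ⟨y, hy, hyi⟩ := halg.exists_integral_multiple
    refine ⟨y.natAbs, by omega, ?_⟩
    rw [zsmul_eq_mul] at hyi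
    rcases Int.natAbs_eq y with h | h
    · rw [h] at hyi
      simpa using hyi
    · rw [h] at hyi
      have := hyi.neg
      simpa using this
  obtain ⟨R, hR, d', hliou⟩ := liou ((a : ℝ) * θ) haint
  obtain ⟨C, hC, hmain⟩ := lam_lower hirr a ha R hR d' hliou
  have hε : 0 < Real.log (Real.log 3) := Real.log_pos one_le_log_three
  set ε := Real.log (Real.log 3) with hεd
  have hq0 : 0 < (2 + |Real.log θ| + |Real.log α|) / ε := by positivity
  refine ⟨C + (2 + |Real.log θ| + |Real.log α|) / ε, by positivity, ?_⟩
  intro h1 h2 r1 r2 Mx hh1 hh2 hr1 hr2 hm1 hm2 hm3 hm4 hMx hne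
  have hMr : (3 : ℝ) ≤ Mx := by exact_mod_cast hMx
  have hH3 : Real.log 3 ≤ Real.log Mx := Real.log_le_log (by norm_num) hMr
  set H := Real.log Mx with hHdef
  have hH1 : 1 < H := one_le_log_three.trans_le hH3
  have hlH : ε ≤ Real.log H := Real.log_le_log (by linarith [one_le_log_three]) hH3
  have hPH : H * ε ≤ H ^ 2 * Real.log H := by
    have : H ≤ H ^ 2 := by nlinarith
    gcongr
  set P := H ^ 2 * Real.log H with hP
  have hP0 : 0 < P := by nlinarith
  have hPq : H * (2 + |Real.log θ| + |Real.log α|) ≤ (2 + |Real.log θ| + |Real.log α|) / ε * P := by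
    rw [div_mul_eq_mul_div, le_div_iff₀ hε]
    have : (2 + |Real.log θ| + |Real.log α|) * (H * ε) ≤ (2 + |Real.log θ| + |Real.log α|) * P := by gcongr
    linarith
  have hPq2 : 2 * H + |Real.log θ| + |Real.log α| ≤ (2 + |Real.log θ| + |Real.log α|) / ε * P := by
    have := abs_nonneg (Real.log θ)
    have := abs_nonneg (Real.log α)
    nlinarith
  set q := (2 + |Real.log θ| + |Real.log α|) / ε with hq
  have hrep : ∀ h r : ℕ, 0 < h → 0 < r →
      (h : ℝ) ^ α * (r : ℝ) ^ β = Real.exp (α * (Real.log h + θ * Real.log r)) := by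
    intro h r hh hr
    rw [Real.rpow_def_of_pos (by exact_mod_cast hh), Real.rpow_def_of_pos (by exact_mod_cast hr), ← Real.exp_add]
    congr 1
    rw [hθd]
    field_simp
  have hnn : ∀ h r : ℕ, 0 ≤ α * (Real.log h + θ * Real.log r) := by
    intro h r
    have := Real.log_natCast_nonneg h
    have := Real.log_natCast_nonneg r
    positivity
  have hdiff : α * (Real.log h1 + θ * Real.log r1) - α * (Real.log h2 + θ * Real.log r2) =
      α * (Real.log ((h1 : ℝ) / h2) + θ * Real.log ((r1 : ℝ) / r2)) := by
    rw [Real.log_div (by positivity) (by positivity), Real.log_div (by positivity) (by positivity)]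
    ring
  have hge := exp_sub_exp_abs (hnn h1 r1) (hnn h2 r2)
  rw [← hrep h1 r1 hh1 hr1, ← hrep h2 r2 hh2 hr2, hdiff, abs_mul, abs_of_pos hα] at hge
  refine lt_of_lt_of_le ?_ hge
  have hαe : Real.exp (-|Real.log α|) ≤ α := by
    rw [← Real.le_log_iff_exp_le hα]
    exact neg_abs_le _
  by_cases hx : h1 = h2
  · have hr : r1 ≠ r2 := by
      rintro rfl
      exact hne (by rw [hx])
    have hl := log_ratio_lower r1 r2 Mx hr1 hr2 hm3 hm4 hr
    have hθe : Real.exp (-|Real.log θ|) ≤ θ := by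
      rw [← Real.le_log_iff_exp_le hθ0]
      exact neg_abs_le _
    have hMe : Real.exp (-H) = 1 / (Mx : ℝ) := by
      rw [Real.exp_neg, hHdef, Real.exp_log (by linarith), one_div]
    rw [hx, div_self (by positivity), Real.log_one, zero_add, abs_mul, abs_of_pos hθ0]
    calc Real.exp (-(C + q) * H ^ 2 * Real.log H) < Real.exp (-|Real.log α| + (-|Real.log θ| + -H)) := by
          rw [Real.exp_lt_exp]
          have e : -(C + q) * H ^ 2 * Real.log H = -(C * P) - q * P := by rw [hP]; ring
          rw [e]
          have : 0 < C * P := by positivity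
          linarith
      _ = Real.exp (-|Real.log α|) * (Real.exp (-|Real.log θ|) * Real.exp (-H)) := by
          rw [Real.exp_add, Real.exp_add]
      _ ≤ _ := by rw [hMe]; gcongr
  · have hl := hmain h1 h2 r1 r2 Mx hh1 hh2 hr1 hr2 hm1 hm2 hm3 hm4 hMx hx
    rw [← hHdef, ← hP] at hl
    calc Real.exp (-(C + q) * H ^ 2 * Real.log H) < Real.exp (-|Real.log α| + -(C * P)) := by
          rw [Real.exp_lt_exp]
          have e : -(C + q) * H ^ 2 * Real.log H = -(C * P) - q * P := by rw [hP]; ring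
          rw [e]
          have := abs_nonneg (Real.log θ)
          linarith
      _ = Real.exp (-|Real.log α|) * Real.exp (-(C * P)) := by rw [Real.exp_add]
      _ ≤ α * |Real.log ((h1 : ℝ) / h2) + θ * Real.log ((r1 : ℝ) / r2)| := by gcongr

end LBE

theorem lower_bound_eta (α β : ℝ) (hα : 0 < α) (hβ : 0 < β)
    (halgα : IsAlgebraic ℚ α) (halgβ : IsAlgebraic ℚ β)
    (hirr : Irrational (β / α)) :
    ∃ C > (0 : ℝ), ∀ h₁ h₂ r₁ r₂ : ℕ+,
      3 ≤ max (max (h₁ : ℕ) (h₂ : ℕ)) (max (r₁ : ℕ) (r₂ : ℕ)) →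
      (h₁ : ℝ) ^ α * (r₁ : ℝ) ^ β ≠ (h₂ : ℝ) ^ α * (r₂ : ℝ) ^ β →
      Real.exp (-C *
          (Real.log ((max (max (h₁ : ℕ) (h₂ : ℕ)) (max (r₁ : ℕ) (r₂ : ℕ)) : ℕ) : ℝ)) ^ 2 *
          Real.log (Real.log ((max (max (h₁ : ℕ) (h₂ : ℕ)) (max (r₁ : ℕ) (r₂ : ℕ)) : ℕ) : ℝ))) <
        |(h₁ : ℝ) ^ α * (r₁ : ℝ) ^ β - (h₂ : ℝ) ^ α * (r₂ : ℝ) ^ β| := by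
  obtain ⟨C, hC, h⟩ := LBE.final α β hα hβ halgα halgβ hirr
  refine ⟨C, hC, fun h₁ h₂ r₁ r₂ hM hne => ?_⟩
  exact h h₁ h₂ r₁ r₂ _ h₁.pos h₂.pos r₁.pos r₂.pos
    (le_max_of_le_left (le_max_left _ _)) (le_max_of_le_left (le_max_right _ _))
    (le_max_of_le_right (le_max_left _ _)) (le_max_of_le_right (le_max_right _ _)) hM hne
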